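/- arXiv:2212.09285 — 4 statements merged into one kernel-verified Lean document; each statement's English description precedes it below -/
import Mathlib

section
/- There are absolute constants K and k (independent of d) such that for every n, every legitimate model ℳ of order n of the class of Boolean circuits over ∪_{a≥2}{¬, ∨_a, ∧_a} with ¬̄ := ¬, every f ∈ ℱ_n, and every d ≥ 8: ρ_d(f, ℳ) ≤ K·n·d·(2^{⌈n/⌊d/8⌋⌉} + 1) + 2^{K·n^{k/d}} + K·n^K. -/
open scoped Classical ENNReal

noncomputable section

/-- Boolean functions on `{0,1}^n`. -/
abbrev BF (n : ℕ) := (Fin n → Bool) → Bool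

/-- A connective: an arity `m` together with a function `{0,1}^m → {0,1}`. -/
abbrev Conn := Σ m : ℕ, (Fin m → Bool) → Bool

/-- A connective is commutative if it is invariant under permutations of its inputs. -/
def Conn.Comm (c : Conn) : Prop :=
  ∀ (π : Equiv.Perm (Fin c.1)) (v : Fin c.1 → Bool), c.2 (v ∘ π) = c.2 v

/-- A Boolean circuit (in straight-line / DAG form) with `n` inputs over the
set of connectives `S`.  Gate `i` may be wired to input variables, constants,
or earlier gates `j < i`; the size is the number of gates. -/
structure Circuit (n : ℕ) (S : Set Conn) where
  size : ℕ
  conn : Fin size → Conn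
  conn_mem : ∀ i, conn i ∈ S
  wires : (i : Fin size) → Fin (conn i).1 → (Fin n ⊕ (Bool ⊕ Fin i.val))
  output : Fin n ⊕ (Bool ⊕ Fin size)

namespace Circuit

variable {n : ℕ} {S : Set Conn}

/-- The value computed at gate `i` on input `x`. -/
def gateVal (C : Circuit n S) (x : Fin n → Bool) : ℕ → Bool
  | i =>
    if h : i < C.size then
      (C.conn ⟨i, h⟩).2 (fun k =>
        match C.wires ⟨i, h⟩ k with
        | Sum.inl v => x v
        | Sum.inr (Sum.inl b) => b
        | Sum.inr (Sum.inr j) => C.gateVal x j.val)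
    else false
termination_by i => i
decreasing_by exact j.isLt

/-- Reading a port (input variable, constant, or gate). -/
def readPort (C : Circuit n S) (x : Fin n → Bool) : (Fin n ⊕ (Bool ⊕ Fin C.size)) → Bool
  | Sum.inl v => x v
  | Sum.inr (Sum.inl b) => b
  | Sum.inr (Sum.inr g) => C.gateVal x g.val

/-- The function computed by the circuit. -/
def eval (C : Circuit n S) (x : Fin n → Bool) : Bool := C.readPort x C.output

def Computes (C : Circuit n S) (f : BF n) : Prop := ∀ x, C.eval x = f x

/-- The depth of gate `i` (number of edges on the longest path to an input or constant). -/
def gateDepth (C : Circuit n S) : ℕ → ℕ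
  | i =>
    if h : i < C.size then
      1 + Finset.univ.sup (fun k =>
        match C.wires ⟨i, h⟩ k with
        | Sum.inl _ => 0
        | Sum.inr (Sum.inl _) => 0
        | Sum.inr (Sum.inr j) => C.gateDepth j.val)
    else 0
termination_by i => i
decreasing_by exact j.isLt

/-- The depth of a circuit. -/
def depth (C : Circuit n S) : ℕ :=
  match C.output with
  | Sum.inl _ => 0
  | Sum.inr (Sum.inl _) => 0
  | Sum.inr (Sum.inr g) => C.gateDepth g.val

/-- The input variables of `C` are among `{x_j : j ∈ J}`. -/
def UsesVars (C : Circuit n S) (J : Set (Fin n)) : Prop :=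
  (∀ (i : Fin C.size) (k : Fin (C.conn i).1) (v : Fin n), C.wires i k = Sum.inl v → v ∈ J) ∧
  (∀ v : Fin n, C.output = Sum.inl v → v ∈ J)

end Circuit

/-- The size of the smallest circuit from the class `CC` computing `f`
(`⊤` if there is none). -/
def sizeIn {n : ℕ} {S : Set Conn} (CC : Set (Circuit n S)) (f : BF n) : ℕ∞ :=
  sInf {t : ℕ∞ | ∃ C ∈ CC, C.Computes f ∧ t = (C.size : ℕ∞)}

/-- Negation, binary conjunction and binary disjunction. -/
abbrev notConn : Conn := ⟨1, fun v => !(v 0)⟩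
abbrev andConn : Conn := ⟨2, fun v => v 0 && v 1⟩
abbrev orConn : Conn := ⟨2, fun v => v 0 || v 1⟩

/-- The connectives `{¬, ∧₂, ∨₂}`. -/
def S3 : Set Conn := {notConn, andConn, orConn}

/-- Unbounded fan-in conjunction and disjunction. -/
abbrev bigAnd (a : ℕ) : Conn := ⟨a, fun v => decide (∀ i, v i = true)⟩
abbrev bigOr (a : ℕ) : Conn := ⟨a, fun v => decide (∃ i, v i = true)⟩

/-- The connectives `∪_{a ≥ 2} {¬, ∧_a, ∨_a}`. -/
def Sunb : Set Conn := {c | c = notConn ∨ ∃ a : ℕ, 2 ≤ a ∧ (c = bigAnd a ∨ c = bigOr a)}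

/-- The connectives `∪_{2 ≤ a ≤ t} {¬, ∧_a, ∨_a}`. -/
def Sbdd (t : ℕ) : Set Conn :=
  {c | c = notConn ∨ ∃ a : ℕ, 2 ≤ a ∧ a ≤ t ∧ (c = bigAnd a ∨ c = bigOr a)}

/-- A legitimate model of order `n` of the circuit class with connectives `S`:
a set `M` of Boolean functions containing the constants and the variables,
together with a commutative approximating operation `∘̄ : M^m → M` for each
connective `∘ ∈ S` of arity `m`. -/
structure LegitModel (n : ℕ) (S : Set Conn) where
  M : Set (BF n)
  const_mem : ∀ b : Bool, (fun _ => b) ∈ M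
  var_mem : ∀ i : Fin n, (fun x => x i) ∈ M
  approx : (c : Conn) → c ∈ S → ((Fin c.1 → M) → M)
  approx_comm : ∀ (c : Conn) (hc : c ∈ S) (π : Equiv.Perm (Fin c.1)) (fs : Fin c.1 → M),
      approx c hc (fs ∘ π) = approx c hc fs

namespace LegitModel

variable {n : ℕ} {S : Set Conn}

/-- The error set `δ_∘(f_1,…,f_m) = ∘(f_1,…,f_m) ⊕ ∘̄(f_1,…,f_m)`. -/
def errSet (Mdl : LegitModel n S) (c : Conn) (hc : c ∈ S) (fs : Fin c.1 → Mdl.M) :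
    Set (Fin n → Bool) :=
  {x | c.2 (fun k => (fs k).1 x) ≠ (Mdl.approx c hc fs).1 x}

/-- The collection `Δ` of all error sets of the model. -/
def Delta (Mdl : LegitModel n S) : Set (Set (Fin n → Bool)) :=
  {δ | ∃ c : Conn, ∃ hc : c ∈ S, ∃ fs : Fin c.1 → Mdl.M, δ = Mdl.errSet c hc fs}

/-- `f ⊕ g` can be covered by `t` error sets, for some `g ∈ M`. -/
def CoversWith (Mdl : LegitModel n S) (f : BF n) (t : ℕ) : Prop :=
  ∃ g, g ∈ Mdl.M ∧ ∃ δs : Fin t → Set (Fin n → Bool),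
    (∀ i, δs i ∈ Mdl.Delta) ∧ ∀ x, f x ≠ g x → ∃ i, x ∈ δs i

/-- The distance `ρ(f, M)`: the minimal number of error sets needed to cover
`f ⊕ g` for some `g ∈ M` (`⊤` if impossible). -/
def rho (Mdl : LegitModel n S) (f : BF n) : ℕ∞ :=
  sInf {t : ℕ∞ | ∃ k : ℕ, t = (k : ℕ∞) ∧ Mdl.CoversWith f k}

/-- The approximating operation for negation is exact negation (`¬̄ := ¬`). -/
def NegExact (Mdl : LegitModel n S) : Prop :=
  ∀ (hc : notConn ∈ S) (fs : Fin 1 → Mdl.M),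
    (Mdl.approx notConn hc fs).1 = fun x => !((fs 0).1 x)

end LegitModel

namespace Circuit

/-- The approximator of gate `i`, where the circuit inputs are substituted by
functions `σ` from the model. -/
def gateApproxWith {n n' : ℕ} {S : Set Conn} (Mdl : LegitModel n S) (C : Circuit n' S)
    (σ : Fin n' → Mdl.M) : ℕ → Mdl.M
  | i =>
    if h : i < C.size then
      Mdl.approx (C.conn ⟨i, h⟩) (C.conn_mem ⟨i, h⟩) (fun k =>
        match C.wires ⟨i, h⟩ k with
        | Sum.inl v => σ v
        | Sum.inr (Sum.inl b) => ⟨fun _ => b, Mdl.const_mem b⟩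
        | Sum.inr (Sum.inr j) => gateApproxWith Mdl C σ j.val)
    else ⟨fun _ => false, Mdl.const_mem false⟩
termination_by i => i
decreasing_by exact j.isLt

/-- The function computed by the approximating circuit `C̄`, with circuit inputs
substituted by functions `σ` from the model. -/
def approxEvalWith {n n' : ℕ} {S : Set Conn} (Mdl : LegitModel n S) (C : Circuit n' S)
    (σ : Fin n' → Mdl.M) : Mdl.M :=
  match C.output with
  | Sum.inl v => σ v
  | Sum.inr (Sum.inl b) => ⟨fun _ => b, Mdl.const_mem b⟩
  | Sum.inr (Sum.inr g) => gateApproxWith Mdl C σ g.val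

/-- The function computed by the approximating circuit `C̄` (inputs are the variables). -/
def approxEval {n : ℕ} {S : Set Conn} (Mdl : LegitModel n S) (C : Circuit n S) : Mdl.M :=
  approxEvalWith Mdl C (fun i => ⟨fun x => x i, Mdl.var_mem i⟩)

end Circuit

namespace LegitModel

variable {n : ℕ} {S : Set Conn}

/-- Depth-`d` covering: as `CoversWith`, but the approximator `g` is the approximator of a
circuit of depth at most `d` and the input functions of the covering error sets are
approximators of circuits of depth at most `d - 1`. -/
def CoversWithD (Mdl : LegitModel n S) (f : BF n) (d t : ℕ) : Prop :=
  ∃ D : Circuit n S, D.depth ≤ d ∧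
    ∃ δs : Fin t → Set (Fin n → Bool),
      (∀ i, ∃ c : Conn, ∃ hc : c ∈ S, ∃ fs : Fin c.1 → Mdl.M,
        (∀ j, ∃ Cj : Circuit n S, Cj.depth ≤ d - 1 ∧ Circuit.approxEval Mdl Cj = fs j) ∧
        δs i = Mdl.errSet c hc fs) ∧
      ∀ x, f x ≠ (Circuit.approxEval Mdl D).1 x → ∃ i, x ∈ δs i

/-- The `d`-depth distance `ρ_d(f, M)`. -/
def rhoD (Mdl : LegitModel n S) (d : ℕ) (f : BF n) : ℕ∞ :=
  sInf {t : ℕ∞ | ∃ k : ℕ, t = (k : ℕ∞) ∧ Mdl.CoversWithD f d k}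

/-- `0`-projectivity: the approximator of a circuit depends only on the variables
the circuit uses. -/
def ZeroProjective (Mdl : LegitModel n S) : Prop :=
  ∀ (C : Circuit n S) (J : Set (Fin n)), C.UsesVars J →
    ∀ z y : Fin n → Bool, (∀ j ∈ J, z j = y j) →
      (Circuit.approxEval Mdl C).1 z = (Circuit.approxEval Mdl C).1 y

/-- Projectivity: the approximator of a circuit with inputs substituted by
`f_1, …, f_m ∈ M` depends only on the values `f_1(x), …, f_m(x)`. -/
def Projective (Mdl : LegitModel n S) : Prop :=
  ∀ (m : ℕ) (C : Circuit m S) (σ : Fin m → Mdl.M) (z y : Fin n → Bool),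
    (∀ i, (σ i).1 z = (σ i).1 y) →
      (Circuit.approxEvalWith Mdl C σ).1 z = (Circuit.approxEvalWith Mdl C σ).1 y

end LegitModel

/-- `Pr[𝐱 ∈ A]` for a distribution `p` on `{0,1}^n`. -/
def prOf {n : ℕ} (p : (Fin n → Bool) → ℝ) (A : Set (Fin n → Bool)) : ℝ :=
  ∑ x, A.indicator p x

/-- `p` is a (finitely supported) probability distribution on `{0,1}^n`. -/
def IsDistrib {n : ℕ} (p : (Fin n → Bool) → ℝ) : Prop :=
  (∀ x, 0 ≤ p x) ∧ (∑ x, p x) = 1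

/-- The probabilistic distance `ρ(f, M, 𝐱) = min_{g ∈ M} Pr[f(𝐱) ≠ g(𝐱)] / d`. -/
def LegitModel.rhoProb {n : ℕ} {S : Set Conn} (Mdl : LegitModel n S) (f : BF n)
    (p : (Fin n → Bool) → ℝ) (d : ℝ) : ℝ :=
  sInf {r : ℝ | ∃ g ∈ Mdl.M, r = prOf p {x | f x ≠ g x} / d}

/-- The variable `x_i` is essential for `f`. -/
def Essential {n : ℕ} (f : BF n) (i : Fin n) : Prop :=
  ∃ x, f (Function.update x i (!(x i))) ≠ f x

/-- The number `n₀` of essential variables of `f`. -/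
def essCount {n : ℕ} (f : BF n) : ℕ := {i | Essential f i}.ncard

/-- An oracle circuit: a circuit over arbitrary (possibly noncommutative) connectives,
together with a set of at most `k` designated oracle gates of arity `m`; all other
gates use connectives from `S`. -/
structure OracleCircuit (n : ℕ) (S : Set Conn) (k m : ℕ) where
  base : Circuit n Set.univ
  oracleGates : Finset (Fin base.size)
  card_le : oracleGates.card ≤ k
  arity_eq : ∀ i ∈ oracleGates, (base.conn i).1 = m
  conn_mem : ∀ i, i ∉ oracleGates → base.conn i ∈ S

/-- An oracle circuit whose `k` oracle gates of arity `m` are at the bottom, with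
inputs among the literals `x_1, ¬x_1, …, x_n, ¬x_n`: each oracle `i` reads the
literals described by `lits i`, and the top circuit over `S` has the `n` variables
and the `k` oracle outputs as inputs.  Its size is `top.size + k`. -/
structure BottomOracleCircuit (n k m : ℕ) (S : Set Conn) where
  oracles : Fin k → (Fin m → Bool) → Bool
  lits : Fin k → Fin m → Fin n × Bool
  top : Circuit (n + k) S

/-- Evaluation of a bottom-oracle circuit. -/
def BottomOracleCircuit.eval {n k m : ℕ} {S : Set Conn} (C : BottomOracleCircuit n k m S)
    (x : Fin n → Bool) : Bool :=
  C.top.eval (Fin.append x (fun i => C.oracles i (fun j => x (C.lits i j).1 == (C.lits i j).2)))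

/-- Ceiling division `⌈a / b⌉` on natural numbers. -/
def natCeilDiv (a b : ℕ) : ℕ := (a + b - 1) / b

end

noncomputable section

namespace S9

open Circuit

variable {n : ℕ} {S : Set Conn}

/-- Value of a port. -/
def pval (Mdl : LegitModel n S) (C : Circuit n S) {s : ℕ} : (Fin n ⊕ (Bool ⊕ Fin s)) → Mdl.M
  | Sum.inl v => ⟨fun x => x v, Mdl.var_mem v⟩
  | Sum.inr (Sum.inl b) => ⟨fun _ => b, Mdl.const_mem b⟩
  | Sum.inr (Sum.inr j) => gateApproxWith Mdl C (fun i => ⟨fun x => x i, Mdl.var_mem i⟩) j.val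

def pdep (C : Circuit n S) {s : ℕ} : (Fin n ⊕ (Bool ⊕ Fin s)) → ℕ
  | Sum.inl _ => 0
  | Sum.inr (Sum.inl _) => 0
  | Sum.inr (Sum.inr j) => C.gateDepth j.val

abbrev gA (Mdl : LegitModel n S) (C : Circuit n S) (i : ℕ) : Mdl.M :=
  gateApproxWith Mdl C (fun i => ⟨fun x => x i, Mdl.var_mem i⟩) i

theorem gA_eq (Mdl : LegitModel n S) (C : Circuit n S) (i : ℕ) (h : i < C.size) :
    gA Mdl C i = Mdl.approx (C.conn ⟨i, h⟩) (C.conn_mem ⟨i, h⟩)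
      (fun k => pval Mdl C (C.wires ⟨i, h⟩ k)) := by
  unfold gA
  rw [gateApproxWith, dif_pos h]
  congr 1
  funext k
  rcases C.wires ⟨i, h⟩ k with v | b | j <;> rfl

theorem gD_eq (C : Circuit n S) (i : ℕ) (h : i < C.size) :
    C.gateDepth i = 1 + Finset.univ.sup (fun k => pdep C (C.wires ⟨i, h⟩ k)) := by
  rw [gateDepth, dif_pos h]
  congr 2
  funext k
  rcases C.wires ⟨i, h⟩ k with v | b | j <;> rfl

/-- A gate at position `i`. -/
abbrev Gate (n : ℕ) (S : Set Conn) (i : ℕ) :=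
  Σ c : {c : Conn // c ∈ S}, (Fin c.1.1 → (Fin n ⊕ (Bool ⊕ Fin i)))

def castGate {a b : ℕ} (h : a = b) (g : Gate n S a) : Gate n S b := by
  subst h
  exact g

def snocGates (C : Circuit n S) (g : Gate n S C.size) (i : Fin (C.size + 1)) : Gate n S i.val :=
  if h : i.val < C.size then ⟨⟨C.conn ⟨i, h⟩, C.conn_mem _⟩, C.wires ⟨i, h⟩⟩
  else castGate (show C.size = i.val by omega) g

def snoc (C : Circuit n S) (g : Gate n S C.size) : Circuit n S where
  size := C.size + 1
  conn i := (snocGates C g i).1.1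
  conn_mem i := (snocGates C g i).1.2
  wires i := (snocGates C g i).2
  output := Sum.inr (Sum.inr ⟨C.size, by omega⟩)

def gval (Mdl : LegitModel n S) (C : Circuit n S) {i : ℕ} (g : Gate n S i) : Mdl.M :=
  Mdl.approx g.1.1 g.1.2 (fun k => pval Mdl C (g.2 k))

def gdep (C : Circuit n S) {i : ℕ} (g : Gate n S i) : ℕ :=
  1 + Finset.univ.sup (fun k => pdep C (g.2 k))

theorem snoc_lt (Mdl : LegitModel n S) (C : Circuit n S) (g : Gate n S C.size) (i : ℕ) :
    i < C.size → gA Mdl (snoc C g) i = gA Mdl C i ∧ (snoc C g).gateDepth i = C.gateDepth i := by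
  induction i using Nat.strong_induction_on with
  | _ i ih =>
    intro h
    have h' : i < (snoc C g).size := Nat.lt_succ_of_lt h
    have hg : snocGates C g ⟨i, h'⟩ = ⟨⟨C.conn ⟨i, h⟩, C.conn_mem _⟩, C.wires ⟨i, h⟩⟩ := by
      unfold snocGates
      rw [dif_pos h]
    have hp : ∀ p : (Fin n ⊕ (Bool ⊕ Fin i)),
        pval Mdl (snoc C g) p = pval Mdl C p ∧ pdep (snoc C g) p = pdep C p := by
      rintro (v | b | j)
      · exact ⟨rfl, rfl⟩
      · exact ⟨rfl, rfl⟩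
      · exact ih j.val j.isLt (by omega)
    constructor
    · rw [gA_eq _ _ _ h', gA_eq _ _ _ h]
      change gval Mdl (snoc C g) (snocGates C g ⟨i, h'⟩) = _
      rw [hg]
      unfold gval
      simp only [(hp _).1]
    · rw [gD_eq _ _ h', gD_eq _ _ h]
      change gdep (snoc C g) (snocGates C g ⟨i, h'⟩) = _
      rw [hg]
      unfold gdep
      simp only [(hp _).2]

theorem snoc_last (Mdl : LegitModel n S) (C : Circuit n S) (g : Gate n S C.size) :
    gA Mdl (snoc C g) C.size = gval Mdl C g ∧ (snoc C g).gateDepth C.size = gdep C g := by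
  have h' : C.size < (snoc C g).size := Nat.lt_succ_self _
  have hg : snocGates C g ⟨C.size, h'⟩ = g := by
    unfold snocGates
    rw [dif_neg (lt_irrefl _)]
    rfl
  have hp : ∀ p : (Fin n ⊕ (Bool ⊕ Fin C.size)),
      pval Mdl (snoc C g) p = pval Mdl C p ∧ pdep (snoc C g) p = pdep C p := by
    rintro (v | b | j)
    · exact ⟨rfl, rfl⟩
    · exact ⟨rfl, rfl⟩
    · exact snoc_lt Mdl C g j.val j.isLt
  constructor
  · rw [gA_eq _ _ _ h']
    change gval Mdl (snoc C g) (snocGates C g ⟨C.size, h'⟩) = _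
    rw [hg]
    unfold gval
    simp only [(hp _).1]
  · rw [gD_eq _ _ h']
    change gdep (snoc C g) (snocGates C g ⟨C.size, h'⟩) = _
    rw [hg]
    unfold gdep
    simp only [(hp _).2]

inductive Rep (Mdl : LegitModel n S) : ℕ → Mdl.M → Prop
  | var (e : ℕ) (i : Fin n) : Rep Mdl e ⟨fun x => x i, Mdl.var_mem i⟩
  | const (e : ℕ) (b : Bool) : Rep Mdl e ⟨fun _ => b, Mdl.const_mem b⟩
  | gate (e : ℕ) (c : Conn) (hc : c ∈ S) (fs : Fin c.1 → Mdl.M)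
      (h : ∀ j, Rep Mdl e (fs j)) : Rep Mdl (e + 1) (Mdl.approx c hc fs)

theorem Rep.mono {Mdl : LegitModel n S} {e : ℕ} {g : Mdl.M} (h : Rep Mdl e g) :
    ∀ {e' : ℕ}, e ≤ e' → Rep Mdl e' g := by
  induction h with
  | var e i => intro e' _; exact Rep.var e' i
  | const e b => intro e' _; exact Rep.const e' b
  | gate e c hc fs h ih =>
    intro e' he
    obtain ⟨e'', rfl⟩ : ∃ e'', e' = e'' + 1 := ⟨e' - 1, by omega⟩
    exact Rep.gate e'' c hc fs (fun j => ih j (by omega))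

def Ext (Mdl : LegitModel n S) (B B' : Circuit n S) : Prop :=
  B.size ≤ B'.size ∧ ∀ i < B.size, gA Mdl B' i = gA Mdl B i ∧ B'.gateDepth i = B.gateDepth i

theorem Ext.trans {Mdl : LegitModel n S} {A B C : Circuit n S} (h1 : Ext Mdl A B)
    (h2 : Ext Mdl B C) : Ext Mdl A C := by
  refine ⟨h1.1.trans h2.1, fun i hi => ?_⟩
  have a := h1.2 i hi
  have b := h2.2 i (lt_of_lt_of_le hi h1.1)
  exact ⟨b.1.trans a.1, b.2.trans a.2⟩

def HasPort (Mdl : LegitModel n S) (B : Circuit n S) (e : ℕ) (g : Mdl.M) : Prop :=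
  ∃ p : (Fin n ⊕ (Bool ⊕ Fin B.size)), pval Mdl B p = g ∧ pdep B p ≤ e

theorem HasPort.ext {Mdl : LegitModel n S} {B B' : Circuit n S} {e : ℕ} {g : Mdl.M}
    (h : HasPort Mdl B e g) (hE : Ext Mdl B B') : HasPort Mdl B' e g := by
  obtain ⟨p, hp, hd⟩ := h
  rcases p with v | b | j
  · exact ⟨Sum.inl v, hp, Nat.zero_le _⟩
  · exact ⟨Sum.inr (Sum.inl b), hp, Nat.zero_le _⟩
  · have := hE.2 j.val j.isLt
    refine ⟨Sum.inr (Sum.inr ⟨j.val, lt_of_lt_of_le j.isLt hE.1⟩), ?_, ?_⟩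
    · exact this.1.trans hp
    · exact (le_of_eq this.2).trans hd

theorem multi {Mdl : LegitModel n S} {e : ℕ} : ∀ (m : ℕ) (fs : Fin m → Mdl.M)
    (_ : ∀ j, ∀ B : Circuit n S, ∃ B', Ext Mdl B B' ∧ HasPort Mdl B' e (fs j))
    (B : Circuit n S), ∃ B', Ext Mdl B B' ∧ ∀ j, HasPort Mdl B' e (fs j) := by
  intro m
  induction m with
  | zero => intro fs _ B; exact ⟨B, ⟨le_refl _, fun i _ => ⟨rfl, rfl⟩⟩, fun j => j.elim0⟩
  | succ m ih =>
    intro fs h B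
    obtain ⟨B1, hB1, hp1⟩ := ih (fun j => fs j.castSucc) (fun j => h _) B
    obtain ⟨B2, hB2, hp2⟩ := h (Fin.last m) B1
    refine ⟨B2, hB1.trans hB2, fun j => ?_⟩
    refine Fin.lastCases ?_ (fun j => ?_) j
    · exact hp2
    · exact (hp1 j).ext hB2

theorem Rep.build {Mdl : LegitModel n S} {e : ℕ} {g : Mdl.M} (h : Rep Mdl e g) :
    ∀ B : Circuit n S, ∃ B', Ext Mdl B B' ∧ HasPort Mdl B' e g := by
  induction h with
  | var e i =>
    intro B
    exact ⟨B, ⟨le_refl _, fun i _ => ⟨rfl, rfl⟩⟩, Sum.inl i, rfl, Nat.zero_le _⟩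
  | const e b =>
    intro B
    exact ⟨B, ⟨le_refl _, fun i _ => ⟨rfl, rfl⟩⟩, Sum.inr (Sum.inl b), rfl, Nat.zero_le _⟩
  | gate e c hc fs h ih =>
    intro B
    obtain ⟨B1, hB1, hp1⟩ := multi c.1 fs ih B
    choose p hp hd using hp1
    let g : Gate n S B1.size := ⟨⟨c, hc⟩, p⟩
    refine ⟨snoc B1 g, hB1.trans ⟨Nat.le_succ _, fun i hi => snoc_lt Mdl B1 g i hi⟩,
      Sum.inr (Sum.inr ⟨B1.size, Nat.lt_succ_self _⟩), ?_, ?_⟩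
    · refine (snoc_last Mdl B1 g).1.trans ?_
      change Mdl.approx c hc (fun k => pval Mdl B1 (p k)) = _
      congr 1
      funext k
      exact hp k
    · refine (le_of_eq (snoc_last Mdl B1 g).2).trans ?_
      change 1 + Finset.univ.sup (fun k => pdep B1 (p k)) ≤ e + 1
      have : Finset.univ.sup (fun k => pdep B1 (p k)) ≤ e := Finset.sup_le (fun k _ => hd k)
      omega

theorem Rep.circuit {Mdl : LegitModel n S} {e : ℕ} {g : Mdl.M} (h : Rep Mdl e g) :
    ∃ C : Circuit n S, C.depth ≤ e ∧ Circuit.approxEval Mdl C = g := by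
  obtain ⟨B, -, p, hp, hd⟩ := h.build
    ⟨0, fun i => i.elim0, fun i => i.elim0, fun i => i.elim0, Sum.inr (Sum.inl false)⟩
  refine ⟨⟨B.size, B.conn, B.conn_mem, B.wires, p⟩, ?_, ?_⟩
  · have hD : ∀ i, (⟨B.size, B.conn, B.conn_mem, B.wires, p⟩ : Circuit n S).gateDepth i
        = B.gateDepth i := by
      intro i
      induction i using Nat.strong_induction_on with
      | _ i ih =>
        by_cases hi : i < B.size
        · refine (gD_eq (⟨B.size, B.conn, B.conn_mem, B.wires, p⟩ : Circuit n S) i hi).trans (Eq.trans ?_ (gD_eq B i hi).symm)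
          congr 2
          funext k
          change pdep _ (B.wires ⟨i, hi⟩ k) = pdep _ (B.wires ⟨i, hi⟩ k)
          rcases B.wires ⟨i, hi⟩ k with v | b | j
          · rfl
          · rfl
          · exact ih j.val j.isLt
        · rw [gateDepth, dif_neg hi, gateDepth, dif_neg hi]
    rcases p with v | b | j
    · exact Nat.zero_le _
    · exact Nat.zero_le _
    · exact (le_of_eq (hD j.val)).trans hd
  · have hD : ∀ i, gA Mdl (⟨B.size, B.conn, B.conn_mem, B.wires, p⟩ : Circuit n S) i
        = gA Mdl B i := by
      intro i
      induction i using Nat.strong_induction_on with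
      | _ i ih =>
        by_cases hi : i < B.size
        · refine (gA_eq Mdl (⟨B.size, B.conn, B.conn_mem, B.wires, p⟩ : Circuit n S) i hi).trans (Eq.trans ?_ (gA_eq Mdl B i hi).symm)
          congr 1
          funext k
          change pval Mdl _ (B.wires ⟨i, hi⟩ k) = pval Mdl _ (B.wires ⟨i, hi⟩ k)
          rcases B.wires ⟨i, hi⟩ k with v | b | j
          · rfl
          · rfl
          · exact ih j.val j.isLt
        · unfold gA
          rw [gateApproxWith, dif_neg hi, gateApproxWith, dif_neg hi]
    rw [← hp]
    rcases p with v | b | j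
    · rfl
    · rfl
    · exact hD j.val

/-- Error sets with inputs of depth at most `e`. -/
def IsErr (Mdl : LegitModel n S) (e : ℕ) (δ : Set (Fin n → Bool)) : Prop :=
  ∃ c : Conn, ∃ hc : c ∈ S, ∃ fs : Fin c.1 → Mdl.M,
    (∀ j, Rep Mdl e (fs j)) ∧ δ = Mdl.errSet c hc fs

theorem IsErr.mono {Mdl : LegitModel n S} {e e' : ℕ} {δ : Set (Fin n → Bool)}
    (h : IsErr Mdl e δ) (he : e ≤ e') : IsErr Mdl e' δ := by
  obtain ⟨c, hc, fs, hf, rfl⟩ := h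
  exact ⟨c, hc, fs, fun j => (hf j).mono he, rfl⟩

theorem rhoD_le {Mdl : LegitModel n S} {f : BF n} {d : ℕ} {ι : Type} [Fintype ι]
    (g : Mdl.M) (hg : Rep Mdl d g) (δ : ι → Set (Fin n → Bool))
    (hδ : ∀ i, IsErr Mdl (d - 1) (δ i))
    (hc : ∀ x, f x ≠ g.1 x → ∃ i, x ∈ δ i) : Mdl.rhoD d f ≤ (Fintype.card ι : ℕ∞) := by
  apply sInf_le
  refine ⟨Fintype.card ι, rfl, ?_⟩
  obtain ⟨D, hD, hDg⟩ := hg.circuit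
  refine ⟨D, hD, fun i => δ ((Fintype.equivFin ι).symm i), ?_, ?_⟩
  · intro i
    obtain ⟨c, hc, fs, hf, h⟩ := hδ ((Fintype.equivFin ι).symm i)
    exact ⟨c, hc, fs, fun j => (hf j).circuit, h⟩
  · intro x hx
    rw [hDg] at hx
    obtain ⟨i, hi⟩ := hc x hx
    exact ⟨Fintype.equivFin ι i, by simpa using hi⟩

/-! Gates over arbitrary finite index types. -/

theorem and_mem {a : ℕ} (h : 2 ≤ a) : bigAnd a ∈ Sunb := Or.inr ⟨a, h, Or.inl rfl⟩
theorem or_mem {a : ℕ} (h : 2 ≤ a) : bigOr a ∈ Sunb := Or.inr ⟨a, h, Or.inr rfl⟩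
theorem not_mem : notConn ∈ Sunb := Or.inl rfl

section
variable (Mdl : LegitModel n Sunb) {ι : Type} [Fintype ι]

def bAnd (h : 2 ≤ Fintype.card ι) (g : ι → Mdl.M) : Mdl.M :=
  Mdl.approx (bigAnd (Fintype.card ι)) (and_mem h) (fun i => g ((Fintype.equivFin ι).symm i))

def bOr (h : 2 ≤ Fintype.card ι) (g : ι → Mdl.M) : Mdl.M :=
  Mdl.approx (bigOr (Fintype.card ι)) (or_mem h) (fun i => g ((Fintype.equivFin ι).symm i))

def eAnd (h : 2 ≤ Fintype.card ι) (g : ι → Mdl.M) : Set (Fin n → Bool) :=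
  Mdl.errSet (bigAnd (Fintype.card ι)) (and_mem h) (fun i => g ((Fintype.equivFin ι).symm i))

def eOr (h : 2 ≤ Fintype.card ι) (g : ι → Mdl.M) : Set (Fin n → Bool) :=
  Mdl.errSet (bigOr (Fintype.card ι)) (or_mem h) (fun i => g ((Fintype.equivFin ι).symm i))

def nNot (g : Mdl.M) : Mdl.M := Mdl.approx notConn not_mem (fun _ => g)

variable {Mdl}

theorem bAnd_rep {h : 2 ≤ Fintype.card ι} {g : ι → Mdl.M} {e : ℕ} (hg : ∀ i, Rep Mdl e (g i)) :
    Rep Mdl (e + 1) (bAnd Mdl h g) := Rep.gate e _ _ _ (fun _ => hg _)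

theorem bOr_rep {h : 2 ≤ Fintype.card ι} {g : ι → Mdl.M} {e : ℕ} (hg : ∀ i, Rep Mdl e (g i)) :
    Rep Mdl (e + 1) (bOr Mdl h g) := Rep.gate e _ _ _ (fun _ => hg _)

theorem nNot_rep {g : Mdl.M} {e : ℕ} (hg : Rep Mdl e g) :
    Rep Mdl (e + 1) (nNot Mdl g) := Rep.gate e _ _ _ (fun _ => hg)

theorem eAnd_isErr {h : 2 ≤ Fintype.card ι} {g : ι → Mdl.M} {e : ℕ}
    (hg : ∀ i, Rep Mdl e (g i)) : IsErr Mdl e (eAnd Mdl h g) :=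
  ⟨_, _, _, fun _ => hg _, rfl⟩

theorem eOr_isErr {h : 2 ≤ Fintype.card ι} {g : ι → Mdl.M} {e : ℕ}
    (hg : ∀ i, Rep Mdl e (g i)) : IsErr Mdl e (eOr Mdl h g) :=
  ⟨_, _, _, fun _ => hg _, rfl⟩

theorem nNot_val (hN : Mdl.NegExact) (g : Mdl.M) (x) : (nNot Mdl g).1 x = !(g.1 x) := by
  have := hN not_mem (fun _ => g)
  exact congrFun this x

theorem bAnd_val {h : 2 ≤ Fintype.card ι} {g : ι → Mdl.M} {x} (hx : x ∉ eAnd Mdl h g) :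
    (bAnd Mdl h g).1 x = true ↔ ∀ i, (g i).1 x = true := by
  have hx' := not_not.1 hx
  unfold bAnd
  rw [← hx', decide_eq_true_iff]
  constructor
  · intro H i
    simpa using H (Fintype.equivFin ι i)
  · intro H i
    exact H _

theorem bOr_val {h : 2 ≤ Fintype.card ι} {g : ι → Mdl.M} {x} (hx : x ∉ eOr Mdl h g) :
    (bOr Mdl h g).1 x = true ↔ ∃ i, (g i).1 x = true := by
  have hx' := not_not.1 hx
  unfold bOr
  rw [← hx', decide_eq_true_iff]
  constructor
  · rintro ⟨i, H⟩
    exact ⟨_, H⟩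
  · rintro ⟨i, H⟩
    exact ⟨Fintype.equivFin ι i, by simpa using H⟩

end

end S9

namespace S9

/-- Probability under the uniform distribution. -/
def pr {Ω : Type} [Fintype Ω] (P : Ω → Prop) : ℝ :=
  ((Finset.univ.filter P).card : ℝ) / (Fintype.card Ω : ℝ)

section
variable {Ω : Type} [Fintype Ω]

theorem pr_eq (P : Ω → Prop) [DecidablePred P] :
    pr P = ((Finset.univ.filter P).card : ℝ) / (Fintype.card Ω : ℝ) := by
  unfold pr
  congr!

theorem pr_nonneg (P : Ω → Prop) : 0 ≤ pr P := by simp only [pr_eq]; positivity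

theorem pr_mono {P Q : Ω → Prop} (h : ∀ w, P w → Q w) : pr P ≤ pr Q := by
  simp only [pr_eq]
  gcongr with w
  exact fun hw => h w hw

theorem pr_or (P Q : Ω → Prop) : pr (fun w => P w ∨ Q w) ≤ pr P + pr Q := by
  simp only [pr_eq]
  rw [← add_div]
  gcongr
  rw [Finset.filter_or]
  exact_mod_cast Finset.card_union_le _ _

theorem pr_exists {ι : Type} [Fintype ι] (P : ι → Ω → Prop) :
    pr (fun w => ∃ i, P i w) ≤ ∑ i, pr (P i) := by
  simp only [pr_eq]
  rw [← Finset.sum_div]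
  gcongr
  have : (Finset.univ.filter (fun w => ∃ i, P i w))
      = Finset.univ.biUnion (fun i => Finset.univ.filter (P i)) := by
    ext w; simp
  rw [this]
  exact_mod_cast Finset.card_biUnion_le

theorem pr_equiv (e : Ω ≃ Ω) (P : Ω → Prop) : pr (fun w => P (e w)) = pr P := by
  simp only [pr_eq]
  congr 2
  refine Finset.card_bij (fun w _ => e w) ?_ ?_ ?_
  · intro a ha; simpa using ha
  · intro a _ b _ h; exact e.injective h
  · intro b hb; exact ⟨e.symm b, by simpa using hb, by simp⟩

theorem pr_not [Nonempty Ω] (P : Ω → Prop) : pr (fun w => ¬ P w) = 1 - pr P := by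
  simp only [pr_eq]
  have h := Finset.card_filter_add_card_filter_not (s := (Finset.univ : Finset Ω)) P
  have h0 : (Fintype.card Ω : ℝ) ≠ 0 := by exact_mod_cast Fintype.card_ne_zero
  field_simp
  rw [eq_sub_iff_add_eq, add_comm]
  exact_mod_cast h

theorem pr_le_one [Nonempty Ω] (P : Ω → Prop) : pr P ≤ 1 := by
  have := pr_nonneg (fun w => ¬ P w)
  rw [pr_not] at this
  linarith

theorem pr_all (k : ℕ) (P : Ω → Prop) :
    pr (fun w : Fin k → Ω => ∀ i, P (w i)) = pr P ^ k := by
  simp only [pr_eq]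
  have : (Finset.univ.filter (fun w : Fin k → Ω => ∀ i, P (w i)))
      = Fintype.piFinset (fun _ => Finset.univ.filter P) := by
    ext w; simp
  rw [this, Fintype.card_piFinset_const]
  simp [div_pow]

theorem exists_of_pr_lt [Nonempty Ω] {P : Ω → Prop} (h : pr P < 1) : ∃ w, ¬ P w := by
  by_contra hh
  push Not at hh
  have : pr P = 1 := by
    have h1 : pr (fun w => ¬ P w) = 0 := by
      simp only [pr_eq]
      simp [hh]
    rw [pr_not] at h1
    linarith
  linarith

theorem pr_prod {q : ℕ} (hq : 0 < q) (P : Fin q → Ω → Prop) :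
    ∑ j, pr (P j) = q * pr (fun w : Fin q × Ω => P w.1 w.2) := by
  simp only [pr_eq]
  rw [← Finset.sum_div]
  have : ((Finset.univ.filter (fun w : Fin q × Ω => P w.1 w.2)).card : ℝ)
      = ∑ j, ((Finset.univ.filter (P j)).card : ℝ) := by
    rw [← Nat.cast_sum]
    congr 1
    simp only [Finset.card_filter]
    rw [Fintype.sum_prod_type]
  rw [this]
  have hq' : (q : ℝ) ≠ 0 := by positivity
  simp only [Fintype.card_prod, Fintype.card_fin, Nat.cast_mul]
  rw [← mul_div_assoc, mul_div_mul_left _ _ hq']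

/-- Hitting lemma. -/
theorem hitting [Nonempty Ω] {n q : ℕ} (hn : 0 < n) (hq : 0 < q)
    (B : (Fin n → Bool) → Ω → Prop) :
    ∃ w : Fin (8 * q * n) → Ω, ∀ x, (∀ i, ¬ B x (w i)) → pr (B x) < 1 / (8 * q) := by
  have hq' : (0 : ℝ) < q := by exact_mod_cast hq
  have key : pr (fun w : Fin (8 * q * n) → Ω =>
      ∃ x, (1 / (8 * q : ℝ) ≤ pr (B x)) ∧ ∀ i, ¬ B x (w i)) < 1 := by
    refine (pr_exists _).trans_lt ?_
    have hb : ∀ x : Fin n → Bool, pr (fun w : Fin (8 * q * n) → Ω =>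
        (1 / (8 * q : ℝ) ≤ pr (B x)) ∧ ∀ i, ¬ B x (w i)) ≤ Real.exp (-(n : ℝ)) := by
      intro x
      by_cases hx : 1 / (8 * q : ℝ) ≤ pr (B x)
      · refine (pr_mono (fun w h => h.2)).trans ?_
        rw [pr_all _ (fun r => ¬ B x r), pr_not]
        have h1 : 1 - pr (B x) ≤ Real.exp (-(1 / (8 * q : ℝ))) := by
          have := Real.add_one_le_exp (-(1 / (8 * q : ℝ)))
          linarith
        have h0 : 0 ≤ 1 - pr (B x) := by linarith [pr_le_one (B x)]
        refine (pow_le_pow_left₀ h0 h1 _).trans ?_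
        rw [← Real.exp_nat_mul]
        apply le_of_eq
        congr 1
        push_cast
        field_simp
      · have : pr (fun w : Fin (8 * q * n) → Ω =>
          (1 / (8 * q : ℝ) ≤ pr (B x)) ∧ ∀ i, ¬ B x (w i)) = 0 := by
          rw [show (fun w : Fin (8 * q * n) → Ω =>
            (1 / (8 * q : ℝ) ≤ pr (B x)) ∧ ∀ i, ¬ B x (w i)) = fun _ => False from
              funext fun w => by simp only [hx, false_and]]
          simp [pr_eq]
        rw [this]
        positivity
    refine (Finset.sum_le_sum (fun x _ => hb x)).trans_lt ?_
    simp only [Finset.sum_const, Finset.card_univ, Fintype.card_fun, Fintype.card_bool,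
      Fintype.card_fin, nsmul_eq_mul, Nat.cast_pow, Nat.cast_ofNat]
    have he : (2 : ℝ) < Real.exp 1 := by
      have := Real.exp_one_gt_d9
      linarith
    have h2 : (2 : ℝ) ^ n < Real.exp n := by
      have := pow_lt_pow_left₀ he (by norm_num) (by omega : n ≠ 0)
      rw [← Real.exp_nat_mul, mul_one] at this
      exact this
    rw [Real.exp_neg, ← div_eq_mul_inv, div_lt_one (Real.exp_pos _)]
    exact h2
  obtain ⟨w, hw⟩ := exists_of_pr_lt key
  refine ⟨w, fun x hx => ?_⟩
  by_contra hh
  exact hw ⟨x, not_lt.1 hh, hx⟩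

/-- Amplification lemma. -/
theorem amplify [Nonempty Ω] {n l : ℕ} (hl : 1 ≤ l) (hl3 : 4 * n + 2 ≤ 3 ^ l)
    (v : (Fin n → Bool) → Ω → Prop) (f : (Fin n → Bool) → Prop) :
    ∃ w : Fin (n + 1) → Fin (2 * 4 ^ (l - 1)) → Fin l → Ω, ∀ x,
      pr (fun r => ¬ (v x r ↔ f x)) ≤ 1 / 4 →
      ((∀ a, ∃ b, ∀ c, v x (w a b c)) ↔ f x) := by
  set m := 2 * 4 ^ (l - 1) with hm
  have hm4 : (m : ℝ) = 4 ^ l / 2 := by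
    obtain ⟨l', rfl⟩ : ∃ l', l = l' + 1 := ⟨l - 1, by omega⟩
    rw [hm]
    simp only [Nat.add_sub_cancel]
    push_cast
    ring
  have hp : ∀ x, pr (fun w : Fin (n + 1) → Fin m → Fin l → Ω =>
      ∀ a, ∃ b, ∀ c, v x (w a b c)) = (1 - (1 - pr (v x) ^ l) ^ m) ^ (n + 1) := by
    intro x
    rw [pr_all (n + 1) (fun u : Fin m → Fin l → Ω => ∃ b, ∀ c, v x (u b c))]
    congr 1
    have : (fun u : Fin m → Fin l → Ω => ∃ b, ∀ c, v x (u b c))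
        = fun u => ¬ ∀ b, ¬ ∀ c, v x (u b c) := by
      funext u
      simp
    rw [this, pr_not, pr_all m (fun t : Fin l → Ω => ¬ ∀ c, v x (t c)), pr_not, pr_all]
  have key : pr (fun w : Fin (n + 1) → Fin m → Fin l → Ω =>
      ∃ x, pr (fun r => ¬ (v x r ↔ f x)) ≤ 1 / 4 ∧
        ¬ ((∀ a, ∃ b, ∀ c, v x (w a b c)) ↔ f x)) < 1 := by
    refine (pr_exists _).trans_lt ?_
    have hb : ∀ x : Fin n → Bool, pr (fun w : Fin (n + 1) → Fin m → Fin l → Ω =>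
        pr (fun r => ¬ (v x r ↔ f x)) ≤ 1 / 4 ∧
        ¬ ((∀ a, ∃ b, ∀ c, v x (w a b c)) ↔ f x)) ≤ (1 / 2) ^ (n + 1) := by
      intro x
      by_cases hx : pr (fun r => ¬ (v x r ↔ f x)) ≤ 1 / 4
      · refine (pr_mono (fun w h => h.2)).trans ?_
        by_cases hf : f x
        · simp only [hf, iff_true] at hx ⊢
          rw [pr_not] at hx
          have h34 : 3 / 4 ≤ pr (v x) := by linarith
          rw [pr_not, hp x]
          set z := (1 - pr (v x) ^ l) ^ m with hz
          have h1 : 0 ≤ 1 - pr (v x) ^ l := by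
            have := pow_le_one₀ (n := l) (pr_nonneg (v x)) (pr_le_one (v x))
            linarith
          have hz0 : 0 ≤ z := pow_nonneg h1 _
          have hz1 : z ≤ 1 := by
            apply pow_le_one₀ h1
            have := pow_nonneg (pr_nonneg (v x)) l
            linarith
          have hzs : z ≤ Real.exp (-(2 * n + 1 : ℝ)) := by
            have h2 : 1 - pr (v x) ^ l ≤ Real.exp (-((3 / 4 : ℝ) ^ l)) := by
              have := Real.add_one_le_exp (-((3 / 4 : ℝ) ^ l))
              have := pow_le_pow_left₀ (by norm_num) h34 l
              linarith
            refine (pow_le_pow_left₀ h1 h2 m).trans ?_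
            rw [← Real.exp_nat_mul, hm4]
            apply Real.exp_le_exp.2
            have : (4 : ℝ) ^ l / 2 * -(3 / 4) ^ l = -(3 ^ l / 2) := by
              rw [div_pow]
              field_simp
            rw [this]
            have h3 : (4 * n + 2 : ℝ) ≤ 3 ^ l := by exact_mod_cast hl3
            linarith
          have hbern : 1 - (n + 1 : ℕ) * z ≤ (1 - z) ^ (n + 1) := by
            have := one_add_mul_le_pow (a := -z) (by linarith) (n + 1)
            rw [← sub_eq_add_neg] at this
            linarith
          have hn2 : ((n + 1 : ℕ) : ℝ) ≤ 2 ^ n := by exact_mod_cast Nat.lt_two_pow_self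
          have he : (2 : ℝ) ≤ Real.exp 1 := by
            have := Real.exp_one_gt_d9
            linarith
          have h2e : (2 : ℝ) ^ (2 * n + 1) ≤ Real.exp (2 * n + 1) := by
            have := pow_le_pow_left₀ (by norm_num) he (2 * n + 1)
            rw [← Real.exp_nat_mul, mul_one] at this
            exact_mod_cast this
          have hz2 : z ≤ (1 / 2) ^ (2 * n + 1) := by
            refine hzs.trans ?_
            rw [Real.exp_neg, one_div, inv_pow]
            exact inv_anti₀ (by positivity) h2e
          calc 1 - (1 - z) ^ (n + 1) ≤ (n + 1 : ℕ) * z := by linarith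
            _ ≤ 2 ^ n * (1 / 2) ^ (2 * n + 1) := by gcongr
            _ = (1 / 2) ^ (n + 1) := by
              rw [show 2 * n + 1 = n + (n + 1) by ring, pow_add, ← mul_assoc, ← mul_pow]
              norm_num
        · simp only [hf, iff_false, not_not] at hx ⊢
          rw [hp x]
          have h4 : pr (v x) ^ l ≤ (1 / 4) ^ l := pow_le_pow_left₀ (pr_nonneg _) hx l
          have hp0 := pow_nonneg (pr_nonneg (v x)) l
          have hp1 := pow_le_one₀ (n := l) (pr_nonneg (v x)) (pr_le_one (v x))
          have hbern := one_add_mul_le_pow (a := -(pr (v x) ^ l)) (by linarith) m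
          rw [← sub_eq_add_neg] at hbern
          have : (m : ℝ) * (pr (v x) ^ l) ≤ 1 / 2 := by
            calc (m : ℝ) * (pr (v x) ^ l) ≤ 4 ^ l / 2 * (1 / 4) ^ l := by
                  rw [hm4]; gcongr
              _ = 1 / 2 := by
                rw [one_div_pow]; field_simp
          apply pow_le_pow_left₀
          · have : (1 - pr (v x) ^ l) ^ m ≤ 1 := pow_le_one₀ (by linarith) (by linarith)
            linarith
          · linarith
      · have : pr (fun w : Fin (n + 1) → Fin m → Fin l → Ω =>
            pr (fun r => ¬ (v x r ↔ f x)) ≤ 1 / 4 ∧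
            ¬ ((∀ a, ∃ b, ∀ c, v x (w a b c)) ↔ f x)) = 0 := by
          rw [show (fun w : Fin (n + 1) → Fin m → Fin l → Ω =>
            pr (fun r => ¬ (v x r ↔ f x)) ≤ 1 / 4 ∧
            ¬ ((∀ a, ∃ b, ∀ c, v x (w a b c)) ↔ f x)) = fun _ => False from
              funext fun w => by simp only [hx, false_and]]
          simp only [pr_eq]
          simp
        rw [this]
        positivity
    refine (Finset.sum_le_sum (fun x _ => hb x)).trans_lt ?_
    simp only [Finset.sum_const, Finset.card_univ, Fintype.card_fun, Fintype.card_bool,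
      Fintype.card_fin, nsmul_eq_mul, Nat.cast_pow, Nat.cast_ofNat]
    rw [pow_succ, ← mul_assoc, ← mul_pow]
    norm_num
  obtain ⟨w, hw⟩ := exists_of_pr_lt key
  refine ⟨w, fun x hx => ?_⟩
  by_contra hh
  exact hw ⟨x, hx, hh⟩

end

end S9

namespace S9

section
variable {n : ℕ} (Mdl : LegitModel n Sunb) (b : ℕ)

/-- Extended bits. -/
def xb (x : Fin n → Bool) (i : ℕ) : Bool := if h : i < n then x ⟨i, h⟩ else false

def lit (j : ℕ) (y : Fin b → Bool) (t : Fin b) : Mdl.M :=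
  if h : j * b + t.val < n then
    (if y t = true then ⟨fun x => x ⟨j * b + t.val, h⟩, Mdl.var_mem _⟩
      else nNot Mdl ⟨fun x => x ⟨j * b + t.val, h⟩, Mdl.var_mem _⟩)
  else ⟨fun _ => !(y t), Mdl.const_mem _⟩

theorem lit_rep (j : ℕ) (y : Fin b → Bool) (t : Fin b) : Rep Mdl 1 (lit Mdl b j y t) := by
  unfold lit
  split_ifs
  · exact Rep.var _ _
  · exact nNot_rep (Rep.var _ _)
  · exact Rep.const _ _

theorem lit_val (hN : Mdl.NegExact) (j : ℕ) (y : Fin b → Bool) (t : Fin b) (x) :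
    (lit Mdl b j y t).1 x = true ↔ y t = xb x (j * b + t.val) := by
  unfold lit xb
  split_ifs with h1 h2
  · rw [h2]; exact eq_comm
  · rw [nNot_val hN]
    have : y t = false := by simpa using h2
    rw [this]
    change (!(x ⟨j * b + t.val, h1⟩)) = true ↔ false = x ⟨j * b + t.val, h1⟩
    cases x ⟨j * b + t.val, h1⟩ <;> simp
  · change (!(y t)) = true ↔ y t = false
    cases y t <;> simp

def sub (j : ℕ) (y : Fin b → Bool) (R : BF n) : BF n := fun z =>
  R (fun i => if h : j * b ≤ i.val ∧ i.val - j * b < b then y ⟨i.val - j * b, h.2⟩ else z i)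

def hyb (j : ℕ) (x z : Fin n → Bool) : Fin n → Bool := fun i =>
  if i.val < j * b then z i else x i

def blk (j : ℕ) (x : Fin n → Bool) : Fin b → Bool := fun t => xb x (j * b + t.val)

theorem sub_hyb (j : ℕ) (x : Fin n → Bool) (R : BF n) :
    sub b j (blk b j x) (fun z => R (hyb b (j + 1) x z)) = fun z => R (hyb b j x z) := by
  funext z
  unfold sub
  refine congrArg R ?_
  funext i
  unfold hyb blk xb
  have e : (j + 1) * b = j * b + b := by ring
  rw [e]
  beta_reduce
  by_cases h1 : i.val < j * b
  · rw [if_pos (show i.val < j * b + b by omega),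
      dif_neg (show ¬ (j * b ≤ i.val ∧ i.val - j * b < b) by omega), if_pos h1]
  · by_cases h2 : i.val < j * b + b
    · rw [if_pos h2, dif_pos (show j * b ≤ i.val ∧ i.val - j * b < b by omega), if_neg h1]
      have h3 : j * b + (i.val - j * b) = i.val := by omega
      simp only [h3, i.isLt, dif_pos]
    · rw [if_neg h2, if_neg h1]

variable (hb : 1 ≤ b)

theorem card1 {b : ℕ} (hb : 1 ≤ b) : 2 ≤ Fintype.card (Option (Fin b)) := by
  simp; omega

theorem card2 {b : ℕ} (hb : 1 ≤ b) : 2 ≤ Fintype.card (Fin b → Bool) := by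
  simp only [Fintype.card_fun, Fintype.card_bool, Fintype.card_fin]
  calc 2 = 2 ^ 1 := rfl
    _ ≤ 2 ^ b := Nat.pow_le_pow_right (by norm_num) hb

def andIn (j : ℕ) (y : Fin b → Bool) (g : Mdl.M) : Option (Fin b) → Mdl.M
  | none => g
  | some t => lit Mdl b j y t

def CR : ℕ → BF n → Mdl.M
  | 0, R => ⟨fun _ => R (fun _ => false), Mdl.const_mem _⟩
  | j + 1, R => bOr Mdl (card2 hb) (fun y => bAnd Mdl (card1 hb)
      (andIn Mdl b j y (CR j (sub b j y R))))

def muxErr (j : ℕ) (R : BF n) : Option (Fin b → Bool) → Set (Fin n → Bool)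
  | none => eOr Mdl (card2 hb) (fun y => bAnd Mdl (card1 hb)
      (andIn Mdl b j y (CR Mdl b hb j (sub b j y R))))
  | some y => eAnd Mdl (card1 hb) (andIn Mdl b j y (CR Mdl b hb j (sub b j y R)))

theorem CR_rep (j : ℕ) : ∀ R : BF n, Rep Mdl (2 * j + 1) (CR Mdl b hb j R) ∧
    ∀ o, IsErr Mdl (2 * j + 2) (muxErr Mdl b hb j R o) := by
  have step : ∀ j, (∀ R : BF n, Rep Mdl (2 * j + 1) (CR Mdl b hb j R)) → ∀ (R : BF n) y o,
      Rep Mdl (2 * j + 1) (andIn Mdl b j y (CR Mdl b hb j (sub b j y R)) o) := by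
    intro j h R y o
    cases o with
    | none => exact h _
    | some t => exact (lit_rep Mdl b j y t).mono (by omega)
  have main : ∀ j, ∀ R : BF n, Rep Mdl (2 * j + 1) (CR Mdl b hb j R) := by
    intro j
    induction j with
    | zero => intro R; exact Rep.const _ _
    | succ j ih =>
      intro R
      exact bOr_rep (fun y => bAnd_rep (step j ih R y))
  intro R
  refine ⟨main j R, fun o => ?_⟩
  cases o with
  | none => exact eOr_isErr (h := card2 hb) (fun y => bAnd_rep (step j (main j) R y))
  | some y => exact (eAnd_isErr (h := card1 hb) (step j (main j) R y)).mono (by omega)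

theorem mux_val (hN : Mdl.NegExact) (j : ℕ) (R : BF n) (x)
    (hx : ∀ o, x ∉ muxErr Mdl b hb j R o) :
    (CR Mdl b hb (j + 1) R).1 x = (CR Mdl b hb j (sub b j (blk b j x) R)).1 x := by
  rw [Bool.eq_iff_iff]
  rw [CR, bOr_val (hx none)]
  have ha : ∀ y, (bAnd Mdl (card1 hb) (andIn Mdl b j y (CR Mdl b hb j (sub b j y R)))).1 x = true
      ↔ (CR Mdl b hb j (sub b j y R)).1 x = true ∧ y = blk b j x := by
    intro y
    rw [bAnd_val (hx (some y))]
    constructor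
    · intro h
      exact ⟨h none, funext fun t => (lit_val Mdl b hN j y t x).1 (h (some t))⟩
    · rintro ⟨h1, h2⟩ (_ | t)
      · exact h1
      · exact (lit_val Mdl b hN j y t x).2 (congrFun h2 t)
  simp only [ha]
  constructor
  · rintro ⟨y, h, rfl⟩
    exact h
  · intro h
    exact ⟨_, h, rfl⟩

theorem CR_val (hN : Mdl.NegExact) (q : ℕ) (hq : n ≤ q * b) (R : BF n) (x)
    (hx : ∀ j < q, ∀ o, x ∉ muxErr Mdl b hb j (fun z => R (hyb b (j + 1) x z)) o) :
    (CR Mdl b hb q R).1 x = R x := by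
  have : ∀ j ≤ q, (CR Mdl b hb j (fun z => R (hyb b j x z))).1 x = R x := by
    intro j
    induction j with
    | zero =>
      intro _
      change R (hyb b 0 x _) = R x
      congr 1
      funext i
      simp [hyb]
    | succ j ih =>
      intro hj
      rw [mux_val Mdl b hb hN j _ x (hx j (by omega)), sub_hyb]
      exact ih (by omega)
  have h := this q le_rfl
  rw [← h]
  have hR : (fun z => R (hyb b q x z)) = R := by
    funext z
    refine congrArg R ?_
    funext i
    unfold hyb
    rw [if_pos (by have := i.isLt; omega)]
  rw [hR]

/-- translation of the bits in high blocks -/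
def tr (j : ℕ) (x z : Fin n → Bool) : Fin n → Bool := fun i =>
  if i.val < j * b then z i else xor (z i) (x i)

theorem tr_tr (j : ℕ) (x z : Fin n → Bool) : tr b j x (tr b j x z) = z := by
  funext i
  unfold tr
  split_ifs <;> simp

def trE (j : ℕ) (x : Fin n → Bool) : BF n ≃ BF n where
  toFun R := fun z => R (tr b j x z)
  invFun R := fun z => R (tr b j x z)
  left_inv R := by funext z; simp only [tr_tr]
  right_inv R := by funext z; simp only [tr_tr]

def Bad (q : ℕ) (x : Fin n → Bool) (w : Fin q × BF n) : Prop :=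
  ∃ o, x ∈ muxErr Mdl b hb w.1.val (fun z => w.2 (hyb b (w.1.val + 1) (fun _ => false) z)) o

theorem pr_wrong (hN : Mdl.NegExact) (q : ℕ) (hq0 : 0 < q) (hq : n ≤ q * b) (x : Fin n → Bool) :
    pr (fun R : BF n => (CR Mdl b hb q R).1 x ≠ R x) ≤ q * pr (Bad Mdl b hb q x) := by
  have h1 : pr (fun R : BF n => (CR Mdl b hb q R).1 x ≠ R x) ≤
      pr (fun R : BF n => ∃ j : Fin q, ∃ o,
        x ∈ muxErr Mdl b hb j.val (fun z => R (hyb b (j.val + 1) x z)) o) := by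
    apply pr_mono
    intro R hR
    by_contra hh
    push Not at hh
    exact hR (CR_val Mdl b hb hN q hq R x (fun j hj o => hh ⟨j, hj⟩ o))
  refine h1.trans ((pr_exists _).trans (le_of_eq ?_))
  refine Eq.trans ?_ (pr_prod hq0 (fun (j : Fin q) (R : BF n) => ∃ o, x ∈ muxErr Mdl b hb j.val
      (fun z => R (hyb b (j.val + 1) (fun _ => false) z)) o))
  apply Finset.sum_congr rfl
  intro j _
  refine Eq.trans ?_ (pr_equiv (trE b (j.val + 1) x) (fun (R : BF n) => ∃ o,
    x ∈ muxErr Mdl b hb j.val (fun z => R (hyb b (j.val + 1) (fun _ => false) z)) o))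
  congr 1
  funext R
  have : (fun z => R (hyb b (j.val + 1) x z))
      = fun z => (trE b (j.val + 1) x R) (hyb b (j.val + 1) (fun _ => false) z) := by
    funext z
    change R _ = R _
    congr 1
    funext i
    unfold hyb tr
    by_cases h : i.val < (j.val + 1) * b <;> simp [h]
  rw [this]

/-- The exclusive-or layer. -/
def xorE (f : BF n) : BF n ≃ BF n where
  toFun R := fun z => xor (R z) (f z)
  invFun R := fun z => xor (R z) (f z)
  left_inv R := by funext z; simp
  right_inv R := by funext z; simp

def pairIn (u v : Mdl.M) (s : Bool) : Bool → Mdl.M := fun t =>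
  match s, t with
  | true, true => u
  | true, false => v
  | false, true => nNot Mdl u
  | false, false => nNot Mdl v

theorem cardB : 2 ≤ Fintype.card Bool := by simp

theorem main (hb : 1 ≤ b) (hn : 1 ≤ n) (hN : Mdl.NegExact) (f : BF n) (q l d : ℕ) (hq0 : 0 < q)
    (hq : n ≤ q * b) (hd : 2 * q + 6 ≤ d) (hl : 1 ≤ l) (hl3 : 4 * n + 2 ≤ 3 ^ l) :
    Mdl.rhoD d f ≤ ((8 * q * n * (2 ^ b + 1) +
      ((n + 1) * (2 * 4 ^ (l - 1)) * l * 2 + ((n + 1) * (2 * 4 ^ (l - 1)) + ((n + 1) + 1))) : ℕ) :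
        ℕ∞) := by
  have : Nonempty (Fin q × BF n) := ⟨(⟨0, hq0⟩, f)⟩
  obtain ⟨w, hw⟩ := hitting (by omega) hq0 (Bad Mdl b hb q)
  let v : (Fin n → Bool) → BF n → Prop := fun x R =>
    xor ((CR Mdl b hb q R).1 x) ((CR Mdl b hb q (xorE f R)).1 x) = true
  have amp := amplify hl hl3 v (fun x => f x = true)
  obtain ⟨m, hm⟩ : ∃ m, m = 2 * 4 ^ (l - 1) := ⟨_, rfl⟩
  rw [← hm] at amp ⊢
  obtain ⟨r, hr⟩ := amp
  have hm2 : 2 ≤ m := by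
    have : 1 ≤ 4 ^ (l - 1) := Nat.one_le_pow _ _ (by norm_num)
    omega
  have c1 : 2 ≤ Fintype.card (Fin l × Bool) := by simp; omega
  have c2 : 2 ≤ Fintype.card (Fin m) := by simpa using hm2
  have c3 : 2 ≤ Fintype.card (Fin (n + 1)) := by simp; omega
  let P : BF n → Bool → Bool → Mdl.M := fun R s =>
    pairIn Mdl (CR Mdl b hb q R) (CR Mdl b hb q (xorE f R)) s
  let g1 : Fin (n + 1) → Fin m → Fin l × Bool → Mdl.M := fun a c i =>
    bOr Mdl cardB (P (r a c i.1) i.2)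
  let g2 : Fin (n + 1) → Fin m → Mdl.M := fun a c => bAnd Mdl c1 (g1 a c)
  let g3 : Fin (n + 1) → Mdl.M := fun a => bOr Mdl c2 (g2 a)
  let g4 : Mdl.M := bAnd Mdl c3 g3
  have hP : ∀ R s t, Rep Mdl (2 * q + 2) (P R s t) := by
    intro R s t
    have h := fun R => (CR_rep Mdl b hb q R).1
    cases s <;> cases t
    · exact nNot_rep (h _)
    · exact nNot_rep (h _)
    · exact (h _).mono (by omega)
    · exact (h _).mono (by omega)
  have h1 : ∀ a c i, Rep Mdl (2 * q + 3) (g1 a c i) := fun a c i => bOr_rep (hP _ _)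
  have h2 : ∀ a c, Rep Mdl (2 * q + 4) (g2 a c) := fun a c => bAnd_rep (h1 a c)
  have h3 : ∀ a, Rep Mdl (2 * q + 5) (g3 a) := fun a => bOr_rep (h2 a)
  have h4 : Rep Mdl (2 * q + 6) g4 := bAnd_rep h3
  let ι := (Fin (8 * q * n) × Option (Fin b → Bool)) ⊕
    ((Fin (n + 1) × Fin m × Fin l × Bool) ⊕ ((Fin (n + 1) × Fin m) ⊕ (Fin (n + 1) ⊕ Unit)))
  let δ : ι → Set (Fin n → Bool) := fun i =>
    match i with
    | Sum.inl (i, o) => muxErr Mdl b hb (w i).1.val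
        (fun z => (w i).2 (hyb b ((w i).1.val + 1) (fun _ => false) z)) o
    | Sum.inr (Sum.inl (a, c, i)) => eOr Mdl cardB (P (r a c i.1) i.2)
    | Sum.inr (Sum.inr (Sum.inl (a, c))) => eAnd Mdl c1 (g1 a c)
    | Sum.inr (Sum.inr (Sum.inr (Sum.inl a))) => eOr Mdl c2 (g2 a)
    | Sum.inr (Sum.inr (Sum.inr (Sum.inr _))) => eAnd Mdl c3 g3
  have key : Mdl.rhoD d f ≤ (Fintype.card ι : ℕ∞) := by
    apply rhoD_le g4 (h4.mono hd) δ
    · rintro (⟨i, o⟩ | ⟨a, c, i⟩ | ⟨a, c⟩ | a | _)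
      · have := (w i).1.isLt
        exact ((CR_rep Mdl b hb _ _).2 o).mono (by omega)
      · exact (eOr_isErr (hP _ _)).mono (by omega)
      · exact (eAnd_isErr (h1 a c)).mono (by omega)
      · exact (eOr_isErr (h2 a)).mono (by omega)
      · exact (eAnd_isErr h3).mono (by omega)
    · intro x hx
      by_contra hh
      push Not at hh
      apply hx
      have hbad : pr (Bad Mdl b hb q x) < 1 / (8 * q) := by
        apply hw
        rintro i ⟨o, ho⟩
        exact hh (Sum.inl (i, o)) ho
      have hq' : (0 : ℝ) < q := by exact_mod_cast hq0
      have hwr : pr (fun R : BF n => (CR Mdl b hb q R).1 x ≠ R x) ≤ 1 / 8 := by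
        refine (pr_wrong Mdl b hb hN q hq0 hq x).trans ?_
        calc (q : ℝ) * pr (Bad Mdl b hb q x) ≤ q * (1 / (8 * q)) := by gcongr
          _ = 1 / 8 := by field_simp
      have hwr2 : pr (fun R : BF n => (CR Mdl b hb q (xorE f R)).1 x ≠ (xorE f R) x) ≤ 1 / 8 := by
        rw [pr_equiv (xorE f) (fun R : BF n => (CR Mdl b hb q R).1 x ≠ R x)]
        exact hwr
      have hv : pr (fun R => ¬ (v x R ↔ f x = true)) ≤ 1 / 4 := by
        have : pr (fun R => ¬ (v x R ↔ f x = true)) ≤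
            pr (fun R : BF n => ((CR Mdl b hb q R).1 x ≠ R x) ∨
              ((CR Mdl b hb q (xorE f R)).1 x ≠ (xorE f R) x)) := by
          apply pr_mono
          intro R hR
          by_contra h'
          push Not at h'
          apply hR
          change xor _ _ = true ↔ _
          rw [h'.1, h'.2]
          change xor (R x) (xor (R x) (f x)) = true ↔ _
          simp
        have := this.trans (pr_or _ _)
        linarith
      have hfin := hr x hv
      have e1 : ∀ R, (xor ((CR Mdl b hb q R).1 x) ((CR Mdl b hb q (xorE f R)).1 x) = true) ↔
          ∀ s, ∃ t, (P R s t).1 x = true := by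
        intro R
        simp only [Bool.forall_bool, Bool.exists_bool, P, pairIn, nNot_val hN]
        cases (CR Mdl b hb q R).1 x <;> cases (CR Mdl b hb q (xorE f R)).1 x <;> simp
      have e2 : g4.1 x = true ↔ ∀ a, ∃ c, ∀ i, v x (r a c i) := by
        rw [bAnd_val (hh (Sum.inr (Sum.inr (Sum.inr (Sum.inr ())))))]
        refine forall_congr' fun a => ?_
        rw [bOr_val (hh (Sum.inr (Sum.inr (Sum.inr (Sum.inl a)))))]
        refine exists_congr fun c => ?_
        rw [bAnd_val (hh (Sum.inr (Sum.inr (Sum.inl (a, c)))))]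
        rw [Prod.forall]
        refine forall_congr' fun i => ?_
        refine Iff.trans ?_ (e1 (r a c i)).symm
        refine forall_congr' fun s => ?_
        exact bOr_val (hh (Sum.inr (Sum.inl (a, c, i, s))))
      rw [Bool.eq_iff_iff, e2]
      exact hfin.symm
  refine key.trans (le_of_eq ?_)
  congr 1
  simp only [ι, Fintype.card_sum, Fintype.card_prod, Fintype.card_option, Fintype.card_fun,
    Fintype.card_bool, Fintype.card_fin, Fintype.card_unit]
  ring

end

theorem zeroCase {n : ℕ} (hn : n = 0) (Mdl : LegitModel n Sunb) (f : BF n) (d : ℕ) :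
    Mdl.rhoD d f = 0 := by
  subst hn
  have := rhoD_le (ι := Empty) (d := d) (f := f) (⟨fun _ => f (fun _ => false), Mdl.const_mem _⟩ : Mdl.M)
    (Rep.const _ _) (fun i => i.elim) (fun i => i.elim) (by
      intro x hx
      exact absurd (congrArg f (Subsingleton.elim _ _)) hx)
  simpa using this

theorem exL (n : ℕ) (hn : 1 ≤ n) : ∃ l, 1 ≤ l ∧ 4 * n + 2 ≤ 3 ^ l ∧ 3 ^ l ≤ 18 * n := by
  refine ⟨Nat.clog 3 (4 * n + 2), ?_, Nat.le_pow_clog (by norm_num) _, ?_⟩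
  · exact Nat.clog_pos (by norm_num) (by omega)
  · have hp : 0 < Nat.clog 3 (4 * n + 2) := Nat.clog_pos (by norm_num) (by omega)
    have h := Nat.pow_pred_clog_lt_self (b := 3) (by norm_num) (x := 4 * n + 2) (by omega)
    have e : 3 ^ Nat.clog 3 (4 * n + 2) = 3 ^ (Nat.clog 3 (4 * n + 2)).pred * 3 := by
      rw [← pow_succ]
      congr 1
    omega

theorem cnt (n l : ℕ) (hn : 1 ≤ n) (hl : 1 ≤ l) (h18 : 3 ^ l ≤ 18 * n) :
    (n + 1) * (2 * 4 ^ (l - 1)) * l * 2 + ((n + 1) * (2 * 4 ^ (l - 1)) + ((n + 1) + 1))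
      ≤ 60000 * n ^ 4 := by
  have hm : 2 * 4 ^ (l - 1) ≤ 4 ^ l := by
    obtain ⟨l', rfl⟩ : ∃ l', l = l' + 1 := ⟨l - 1, by omega⟩
    simp only [Nat.add_sub_cancel, pow_succ]
    first | done | omega
  have hl2 : l ≤ 3 ^ l := (Nat.lt_pow_self (by norm_num)).le
  have hm9 : 4 ^ l ≤ (3 ^ l) ^ 2 := by
    rw [← pow_mul, mul_comm, pow_mul]
    exact Nat.pow_le_pow_left (by norm_num) l
  have hM : 2 * 4 ^ (l - 1) ≤ (18 * n) ^ 2 := hm.trans (hm9.trans (Nat.pow_le_pow_left h18 2))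
  have hL : l ≤ 18 * n := hl2.trans h18
  have h2 : n + 1 ≤ 2 * n := by omega
  have hn1 : n ≤ n ^ 4 := Nat.le_self_pow (by norm_num) n
  have hn3 : n ^ 3 ≤ n ^ 4 := Nat.pow_le_pow_right hn (by norm_num)
  calc (n + 1) * (2 * 4 ^ (l - 1)) * l * 2 + ((n + 1) * (2 * 4 ^ (l - 1)) + ((n + 1) + 1))
      ≤ (2 * n) * (18 * n) ^ 2 * (18 * n) * 2 + ((2 * n) * (18 * n) ^ 2 + (2 * n + n)) := by
        gcongr
    _ = 23328 * n ^ 4 + 648 * n ^ 3 + 3 * n := by ring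
    _ ≤ 60000 * n ^ 4 := by omega

end S9

theorem stmt9 :
    ∃ K k : ℕ, ∀ (n : ℕ) (Mdl : LegitModel n Sunb), Mdl.NegExact →
      ∀ (f : BF n) (d : ℕ), 8 ≤ d →
        (Mdl.rhoD d f : ℝ≥0∞) ≤ ENNReal.ofReal
          ((K * n * d : ℕ) * ((2 : ℝ) ^ natCeilDiv n (d / 8) + 1) +
            (2 : ℝ) ^ ((K : ℝ) * (n : ℝ) ^ ((k : ℝ) / (d : ℝ))) +
            (K : ℝ) * (n : ℝ) ^ (K : ℕ)) := by
  refine ⟨60000, 0, fun n Mdl hN f d hd => ?_⟩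
  rcases Nat.eq_zero_or_pos n with hn | hn
  · rw [S9.zeroCase hn]
    simp
  obtain ⟨l, hl, hl3, h18⟩ := S9.exL n hn
  have hq0 : 0 < d / 8 := by omega
  have hqb : n ≤ d / 8 * natCeilDiv n (d / 8) := by
    unfold natCeilDiv
    have h1 := Nat.div_add_mod (n + d / 8 - 1) (d / 8)
    have h2 := Nat.mod_lt (n + d / 8 - 1) hq0
    omega
  have hb : 1 ≤ natCeilDiv n (d / 8) := by
    by_contra h
    have : natCeilDiv n (d / 8) = 0 := by omega
    rw [this] at hqb
    omega
  have h := S9.main Mdl (natCeilDiv n (d / 8)) hb hn hN f (d / 8) l d hq0 hqb (by omega) hl hl3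
  have hc := S9.cnt n l hn hl h18
  have h' := ENat.toENNReal_le.2 h
  refine h'.trans ?_
  rw [ENat.toENNReal_coe, ← ENNReal.ofReal_natCast]
  apply ENNReal.ofReal_le_ofReal
  generalize natCeilDiv n (d / 8) = b at *
  have hA : 8 * (d / 8) * n * (2 ^ b + 1) ≤ 60000 * n * d * (2 ^ b + 1) := by
    apply Nat.mul_le_mul_right
    have : 8 * (d / 8) ≤ d := Nat.mul_div_le d 8
    calc 8 * (d / 8) * n ≤ d * n := Nat.mul_le_mul_right _ this
      _ ≤ 60000 * (d * n) := by omega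
      _ = 60000 * n * d := by ring
  have hpos : (0 : ℝ) ≤ (2 : ℝ) ^ (((60000 : ℕ) : ℝ) * (n : ℝ) ^ (((0 : ℕ) : ℝ) / (d : ℝ))) :=
    Real.rpow_nonneg (by norm_num) _
  have hpow : (n : ℝ) ^ 4 ≤ (n : ℝ) ^ 60000 :=
    pow_le_pow_right₀ (by exact_mod_cast hn) (by norm_num)
  have hA' : ((8 * (d / 8) * n * (2 ^ b + 1) : ℕ) : ℝ)
      ≤ ((60000 * n * d : ℕ) : ℝ) * ((2 : ℝ) ^ b + 1) := by
    have : ((8 * (d / 8) * n * (2 ^ b + 1) : ℕ) : ℝ) ≤ ((60000 * n * d * (2 ^ b + 1) : ℕ) : ℝ) := by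
      exact_mod_cast hA
    rw [Nat.cast_mul (60000 * n * d)] at this
    simpa using this
  have hc' : (((n + 1) * (2 * 4 ^ (l - 1)) * l * 2 +
      ((n + 1) * (2 * 4 ^ (l - 1)) + ((n + 1) + 1)) : ℕ) : ℝ) ≤ 60000 * (n : ℝ) ^ 4 := by
    exact_mod_cast hc
  rw [Nat.cast_add]
  push_cast at hA' hc' hpos ⊢
  linarith

end
end

section
/- For every n, every legitimate model ℳ of order n of the class of Boolean circuits over ∪_{a≥2}{¬, ∨_a, ∧_a} with ¬̄ := ¬, every f ∈ ℱ_n, and every d ≥ 1, there exist a random variable 𝛅 taking values in Δ and a random variable 𝐡 taking values in ℳ such that for every x ∈ {0,1}^n: Pr[𝐡(x) ≠ f(x)] ≤ 4(d+1)(2^{⌈n/d⌉} + 1) · Pr[x ∈ 𝛅]. Moreover, every h in the range of 𝐡 equals D̄ for some circuit D of depth 2d+3, and for every error set δ_∘(f_1,…,f_m) in the range of 𝛅 there are circuits D_i of depth at most 2d+2 with f_i = D̄_i for each i. -/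
open scoped Classical ENNReal

noncomputable section

namespace St10

/-- Depth-bounded approximator derivations. -/
inductive Q {n : ℕ} {S : Set Conn} (Mdl : LegitModel n S) : ℕ → Mdl.M → Prop
  | cst (b : Bool) : Q Mdl 0 ⟨fun _ => b, Mdl.const_mem b⟩
  | var (i : Fin n) : Q Mdl 0 ⟨fun x => x i, Mdl.var_mem i⟩
  | mono {d e : ℕ} {h : Mdl.M} : d ≤ e → Q Mdl d h → Q Mdl e h
  | gate {d : ℕ} (c : Conn) (hc : c ∈ S) (fs : Fin c.1 → Mdl.M) :
      (∀ k, Q Mdl d (fs k)) → Q Mdl (d + 1) (Mdl.approx c hc fs)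

variable {n : ℕ} {S : Set Conn}

abbrev Port (n s : ℕ) := Fin n ⊕ (Bool ⊕ Fin s)

def pVal (Mdl : LegitModel n S) (C : Circuit n S) {s : ℕ} : Port n s → Mdl.M
  | Sum.inl v => ⟨fun x => x v, Mdl.var_mem v⟩
  | Sum.inr (Sum.inl b) => ⟨fun _ => b, Mdl.const_mem b⟩
  | Sum.inr (Sum.inr j) => C.gateApproxWith Mdl (fun i => ⟨fun x => x i, Mdl.var_mem i⟩) j.val

def pDep (C : Circuit n S) {s : ℕ} : Port n s → ℕ
  | Sum.inl _ => 0
  | Sum.inr (Sum.inl _) => 0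
  | Sum.inr (Sum.inr j) => C.gateDepth j.val

def Has (Mdl : LegitModel n S) (C : Circuit n S) (d : ℕ) (h : Mdl.M) : Prop :=
  ∃ p : Port n C.size, pVal Mdl C p = h ∧ pDep C p ≤ d

abbrev Gate (n : ℕ) (S : Set Conn) (i : ℕ) := Σ c : {c : Conn // c ∈ S}, (Fin c.1.1 → Port n i)

def gates (C : Circuit n S) (g : Gate n S C.size) (i : Fin (C.size + 1)) : Gate n S i.val :=
  if h : i.val < C.size then ⟨⟨C.conn ⟨i, h⟩, C.conn_mem ⟨i, h⟩⟩, C.wires ⟨i, h⟩⟩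
  else (show C.size = i.val by omega) ▸ g

def snoc (C : Circuit n S) (g : Gate n S C.size) : Circuit n S where
  size := C.size + 1
  conn i := (gates C g i).1.1
  conn_mem i := (gates C g i).1.2
  wires i := (gates C g i).2
  output := Sum.inr (Sum.inl false)

def PhiV (Mdl : LegitModel n S) (C : Circuit n S) {i : ℕ} (g : Gate n S i) : Mdl.M :=
  Mdl.approx g.1.1 g.1.2 (fun k => pVal Mdl C (g.2 k))

def PhiD (C : Circuit n S) {i : ℕ} (g : Gate n S i) : ℕ :=
  1 + Finset.univ.sup (fun k => pDep C (g.2 k))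

abbrev gA (Mdl : LegitModel n S) (C : Circuit n S) (i : ℕ) : Mdl.M :=
  C.gateApproxWith Mdl (fun i => ⟨fun x => x i, Mdl.var_mem i⟩) i

theorem gA_eq (Mdl : LegitModel n S) (C : Circuit n S) (i : ℕ) (h : i < C.size) :
    gA Mdl C i = PhiV Mdl C (i := i) ⟨⟨C.conn ⟨i, h⟩, C.conn_mem ⟨i, h⟩⟩, C.wires ⟨i, h⟩⟩ := by
  unfold gA
  rw [Circuit.gateApproxWith, dif_pos h]
  unfold PhiV
  congr 1
  funext k
  dsimp only
  rcases C.wires ⟨i, h⟩ k with v | b | j <;> rfl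

theorem gD_eq (C : Circuit n S) (i : ℕ) (h : i < C.size) :
    C.gateDepth i = PhiD C (i := i) ⟨⟨C.conn ⟨i, h⟩, C.conn_mem ⟨i, h⟩⟩, C.wires ⟨i, h⟩⟩ := by
  rw [Circuit.gateDepth, dif_pos h]
  unfold PhiD
  congr 2
  funext k
  dsimp only
  rcases C.wires ⟨i, h⟩ k with v | b | j <;> rfl

theorem snoc_old (Mdl : LegitModel n S) (C : Circuit n S) (g : Gate n S C.size) (i : ℕ) :
    i < C.size → gA Mdl (snoc C g) i = gA Mdl C i ∧ (snoc C g).gateDepth i = C.gateDepth i := by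
  induction i using Nat.strong_induction_on with
  | _ i ih =>
  intro h
  have h' : i < (snoc C g).size := Nat.lt_succ_of_lt h
  have e : gates C g ⟨i, h'⟩ = ⟨⟨C.conn ⟨i, h⟩, C.conn_mem ⟨i, h⟩⟩, C.wires ⟨i, h⟩⟩ := by
    unfold gates; rw [dif_pos h]
  have e' : (⟨⟨(snoc C g).conn ⟨i, h'⟩, (snoc C g).conn_mem ⟨i, h'⟩⟩, (snoc C g).wires ⟨i, h'⟩⟩ :
      Gate n S i) = ⟨⟨C.conn ⟨i, h⟩, C.conn_mem ⟨i, h⟩⟩, C.wires ⟨i, h⟩⟩ := e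
  rw [gA_eq _ _ _ h', gA_eq _ _ _ h, gD_eq _ _ h', gD_eq _ _ h, e']
  unfold PhiV PhiD
  constructor
  · congr 1
    funext k
    dsimp only
    rcases C.wires ⟨i, h⟩ k with v | b | j
    · rfl
    · rfl
    · exact (ih j.val j.isLt (by have := j.isLt; dsimp at this; omega)).1
  · congr 2
    funext k
    dsimp only
    rcases C.wires ⟨i, h⟩ k with v | b | j
    · rfl
    · rfl
    · exact (ih j.val j.isLt (by have := j.isLt; dsimp at this; omega)).2

theorem pVal_snoc (Mdl : LegitModel n S) (C : Circuit n S) (g : Gate n S C.size)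
    (p : Port n C.size) : pVal Mdl (snoc C g) p = pVal Mdl C p ∧ pDep (snoc C g) p = pDep C p := by
  rcases p with v | b | j
  · exact ⟨rfl, rfl⟩
  · exact ⟨rfl, rfl⟩
  · exact snoc_old Mdl C g j.val j.isLt

theorem snoc_new (Mdl : LegitModel n S) (C : Circuit n S) (g : Gate n S C.size) :
    gA Mdl (snoc C g) C.size = PhiV Mdl C g ∧ (snoc C g).gateDepth C.size = PhiD C g := by
  have h' : C.size < (snoc C g).size := Nat.lt_succ_self _
  have e : gates C g ⟨C.size, h'⟩ = g := by
    unfold gates; rw [dif_neg (by simp)]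
  have e' : (⟨⟨(snoc C g).conn ⟨C.size, h'⟩, (snoc C g).conn_mem ⟨C.size, h'⟩⟩,
      (snoc C g).wires ⟨C.size, h'⟩⟩ : Gate n S C.size) = g := e
  rw [gA_eq _ _ _ h', gD_eq _ _ h', e']
  unfold PhiV PhiD
  simp only [(pVal_snoc Mdl C g _).1, (pVal_snoc Mdl C g _).2, and_self]

theorem Has.snoc {Mdl : LegitModel n S} {C : Circuit n S} {d : ℕ} {h : Mdl.M}
    (H : Has Mdl C d h) (g : Gate n S C.size) : Has Mdl (snoc C g) d h := by
  obtain ⟨p, hp, hd⟩ := H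
  rw [← (pVal_snoc Mdl C g p).1] at hp
  rw [← (pVal_snoc Mdl C g p).2] at hd
  rcases p with v | b | j
  · exact ⟨Sum.inl v, hp, hd⟩
  · exact ⟨Sum.inr (Sum.inl b), hp, hd⟩
  · exact ⟨Sum.inr (Sum.inr j.castSucc), hp, hd⟩

theorem Has.gate {Mdl : LegitModel n S} {C : Circuit n S} {d : ℕ} (c : Conn) (hc : c ∈ S)
    (fs : Fin c.1 → Mdl.M) (H : ∀ k, Has Mdl C d (fs k)) :
    ∃ C' : Circuit n S, (∀ e h, Has Mdl C e h → Has Mdl C' e h) ∧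
      Has Mdl C' (d + 1) (Mdl.approx c hc fs) := by
  choose p hp hd using H
  let g : Gate n S C.size := ⟨⟨c, hc⟩, p⟩
  refine ⟨St10.snoc C g, fun e h H => H.snoc g, Sum.inr (Sum.inr (Fin.last _)), ?_, ?_⟩
  · refine (snoc_new Mdl C g).1.trans ?_
    unfold PhiV
    congr 1
    funext k
    exact hp k
  · refine (snoc_new Mdl C g).2.le.trans ?_
    unfold PhiD
    rw [add_comm]
    gcongr
    exact Finset.sup_le fun k _ => hd k

theorem Q.has {Mdl : LegitModel n S} {d : ℕ} {h : Mdl.M} (H : Q Mdl d h) :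
    ∀ C : Circuit n S, ∃ C' : Circuit n S, (∀ e h, Has Mdl C e h → Has Mdl C' e h) ∧
      Has Mdl C' d h := by
  induction H with
  | cst b => exact fun C => ⟨C, fun _ _ h => h, Sum.inr (Sum.inl b), rfl, le_rfl⟩
  | var i => exact fun C => ⟨C, fun _ _ h => h, Sum.inl i, rfl, le_rfl⟩
  | mono hde _ ih =>
    intro C
    obtain ⟨C', h1, p, h2, h3⟩ := ih C
    exact ⟨C', h1, p, h2, h3.trans hde⟩
  | @gate d c hc fs _ ih =>
    intro C
    have key : ∀ s : Finset (Fin c.1), ∃ C' : Circuit n S,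
        (∀ e h, Has Mdl C e h → Has Mdl C' e h) ∧ ∀ k ∈ s, Has Mdl C' d (fs k) := by
      intro s
      induction s using Finset.induction_on with
      | empty => exact ⟨C, fun _ _ h => h, by simp⟩
      | insert a s _ ihs =>
        obtain ⟨C1, h1, h2⟩ := ihs
        obtain ⟨C2, h3, h4⟩ := ih a C1
        refine ⟨C2, fun e h H => h3 e h (h1 e h H), fun k hk => ?_⟩
        rcases Finset.mem_insert.1 hk with rfl | hk
        · exact h4
        · exact h3 _ _ (h2 k hk)
    obtain ⟨C1, h1, h2⟩ := key Finset.univ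
    obtain ⟨C2, h3, h4⟩ := Has.gate c hc fs (fun k => h2 k (Finset.mem_univ _))
    exact ⟨C2, fun e h H => h3 e h (h1 e h H), h4⟩

def emptyC (n : ℕ) (S : Set Conn) : Circuit n S where
  size := 0
  conn i := i.elim0
  conn_mem i := i.elim0
  wires i := i.elim0
  output := Sum.inr (Sum.inl false)

def setOut (C : Circuit n S) (p : Port n C.size) : Circuit n S := { C with output := p }

theorem setOut_gate (Mdl : LegitModel n S) (C : Circuit n S) (p : Port n C.size) (i : ℕ) :
    i < C.size → gA Mdl (setOut C p) i = gA Mdl C i ∧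
      (setOut C p).gateDepth i = C.gateDepth i := by
  induction i using Nat.strong_induction_on with
  | _ i ih =>
  intro h
  rw [gA_eq _ _ _ (show i < (setOut C p).size from h), gA_eq _ _ _ h,
    gD_eq _ _ (show i < (setOut C p).size from h), gD_eq _ _ h]
  unfold PhiV PhiD
  have key : ∀ q : Port n i, pVal Mdl (setOut C p) q = pVal Mdl C q ∧
      pDep (setOut C p) q = pDep C q := by
    rintro (v | b | j)
    · exact ⟨rfl, rfl⟩
    · exact ⟨rfl, rfl⟩
    · exact ih j.val j.isLt (j.isLt.trans h)
  constructor
  · congr 1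
    funext k
    exact (key _).1
  · congr 2
    funext k
    exact (key _).2

theorem Q.circuit {Mdl : LegitModel n S} {d : ℕ} {h : Mdl.M} (H : Q Mdl d h) :
    ∃ C : Circuit n S, C.depth ≤ d ∧ Circuit.approxEval Mdl C = h := by
  obtain ⟨C, -, p, hp, hd⟩ := H.has (emptyC n S)
  refine ⟨setOut C p, ?_, ?_⟩
  · refine le_trans (le_of_eq ?_) hd
    rcases p with v | b | j
    · rfl
    · rfl
    · exact (setOut_gate Mdl C _ j.val j.isLt).2
  · rw [← hp]
    rcases p with v | b | j
    · rfl
    · rfl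
    · exact (setOut_gate Mdl C _ j.val j.isLt).1

def Adm (Mdl : LegitModel n S) (D : ℕ) (δ : Set (Fin n → Bool)) : Prop :=
  ∃ c : Conn, ∃ hc : c ∈ S, ∃ fs : Fin c.1 → Mdl.M,
    (∀ j, Q Mdl D (fs j)) ∧ δ = Mdl.errSet c hc fs

def ind (P : Prop) : ℝ := if P then 1 else 0

theorem ind_le {P : Prop} {r : ℝ} (h0 : 0 ≤ r) (h : P → 1 ≤ r) : ind P ≤ r := by
  unfold ind; split_ifs with hP
  · exact h hP
  · exact h0

theorem ind_nonneg (P : Prop) : 0 ≤ ind P := by unfold ind; split_ifs <;> norm_num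

theorem ind_of {P : Prop} (h : P) : ind P = 1 := if_pos h

def Cov (Mdl : LegitModel n S) (D : ℕ) (K : ℝ) (φ : (Fin n → Bool) → ℝ) : Prop :=
  ∃ W : {δ : Set (Fin n → Bool) // Adm Mdl D δ} → ℝ, (∀ δ, 0 ≤ W δ) ∧ ∑ δ, W δ = K ∧
    ∀ x, φ x ≤ ∑ δ, if x ∈ δ.1 then W δ else 0

variable {Mdl : LegitModel n S} {D : ℕ}

theorem Cov.mono {K : ℝ} {φ ψ : (Fin n → Bool) → ℝ} (h : Cov Mdl D K φ) (hh : ∀ x, ψ x ≤ φ x) :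
    Cov Mdl D K ψ := by
  obtain ⟨W, h0, h1, h2⟩ := h
  exact ⟨W, h0, h1, fun x => (hh x).trans (h2 x)⟩

theorem Cov.zero : Cov Mdl D 0 (fun _ => 0) :=
  ⟨fun _ => 0, by simp, by simp, by simp⟩

theorem Cov.add {K L : ℝ} {φ ψ : (Fin n → Bool) → ℝ} (h : Cov Mdl D K φ) (h' : Cov Mdl D L ψ) :
    Cov Mdl D (K + L) (fun x => φ x + ψ x) := by
  obtain ⟨W, h0, h1, h2⟩ := h
  obtain ⟨V, k0, k1, k2⟩ := h'
  refine ⟨fun δ => W δ + V δ, fun δ => add_nonneg (h0 δ) (k0 δ), ?_, fun x => ?_⟩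
  · rw [Finset.sum_add_distrib, h1, k1]
  · refine (add_le_add (h2 x) (k2 x)).trans (le_of_eq ?_)
    rw [← Finset.sum_add_distrib]
    refine Finset.sum_congr rfl fun δ _ => ?_
    split_ifs <;> simp

theorem Cov.smul {K : ℝ} {φ : (Fin n → Bool) → ℝ} (h : Cov Mdl D K φ) {c : ℝ} (hc : 0 ≤ c) :
    Cov Mdl D (c * K) (fun x => c * φ x) := by
  obtain ⟨W, h0, h1, h2⟩ := h
  refine ⟨fun δ => c * W δ, fun δ => mul_nonneg hc (h0 δ), ?_, fun x => ?_⟩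
  · rw [← Finset.mul_sum, h1]
  · refine (mul_le_mul_of_nonneg_left (h2 x) hc).trans (le_of_eq ?_)
    rw [Finset.mul_sum]
    refine Finset.sum_congr rfl fun δ _ => ?_
    split_ifs <;> simp

theorem Cov.sum {ι : Type} (s : Finset ι) {K : ℝ} {φ : ι → (Fin n → Bool) → ℝ}
    (h : ∀ i, Cov Mdl D K (φ i)) : Cov Mdl D (s.card * K) (fun x => ∑ i ∈ s, φ i x) := by
  induction s using Finset.induction_on with
  | empty => simpa using Cov.zero
  | insert a s ha ih =>
    simp only [Finset.sum_insert ha, Finset.card_insert_of_notMem ha]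
    have := (h a).add ih
    convert this using 1
    push_cast; ring

def avg {ι : Type} [Fintype ι] (φ : ι → ℝ) : ℝ := (Fintype.card ι : ℝ)⁻¹ * ∑ i, φ i

theorem Cov.avg {ι : Type} [Fintype ι] [Nonempty ι] {K : ℝ} {φ : ι → (Fin n → Bool) → ℝ}
    (h : ∀ i, Cov Mdl D K (φ i)) : Cov Mdl D K (fun x => avg fun i => φ i x) := by
  have := (Cov.sum Finset.univ h).smul (c := (Fintype.card ι : ℝ)⁻¹) (by positivity)
  have e : (Fintype.card ι : ℝ)⁻¹ * (((Finset.univ : Finset ι).card : ℝ) * K) = K := by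
    rw [Finset.card_univ, ← mul_assoc, inv_mul_cancel₀, one_mul]
    exact_mod_cast Fintype.card_ne_zero
  rw [e] at this
  exact this

theorem Cov.single {δ : Set (Fin n → Bool)} (h : Adm Mdl D δ) :
    Cov Mdl D 1 (fun x => ind (x ∈ δ)) := by
  refine ⟨fun δ' => if δ' = ⟨δ, h⟩ then 1 else 0, fun δ' => by dsimp only; split_ifs <;> norm_num,
    by simp, fun x => ?_⟩
  apply ind_le
  · refine Finset.sum_nonneg fun i _ => ?_
    dsimp only
    split_ifs <;> norm_num
  · intro hx
    refine le_trans (le_of_eq ?_) (Finset.single_le_sum (a := ⟨δ, h⟩) ?_ (Finset.mem_univ _))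
    · simp [hx]
    · intro i _
      dsimp only
      split_ifs <;> norm_num

theorem avg_mono {ι : Type} [Fintype ι] {φ ψ : ι → ℝ} (h : ∀ i, φ i ≤ ψ i) : avg φ ≤ avg ψ := by
  unfold avg
  gcongr
  exact h _

theorem avg_add {ι : Type} [Fintype ι] (φ ψ : ι → ℝ) :
    (avg fun i => φ i + ψ i) = avg φ + avg ψ := by
  unfold avg
  rw [Finset.sum_add_distrib, mul_add]

theorem avg_equiv {ι κ : Type} [Fintype ι] [Fintype κ] (e : ι ≃ κ) (φ : κ → ℝ) :
    (avg fun i => φ (e i)) = avg φ := by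
  unfold avg
  rw [Fintype.card_congr e, Equiv.sum_comp e]

theorem avg_fst {ι κ : Type} [Fintype ι] [Fintype κ] [Nonempty κ] (φ : ι → ℝ) :
    (avg fun p : ι × κ => φ p.1) = avg φ := by
  unfold avg
  rw [Fintype.sum_prod_type, Fintype.card_prod]
  simp only [Finset.sum_const, Finset.card_univ, nsmul_eq_mul]
  rw [← Finset.mul_sum]
  have : (Fintype.card κ : ℝ) ≠ 0 := by exact_mod_cast Fintype.card_ne_zero
  push_cast
  field_simp

abbrev R (k j : ℕ) := (Fin j → Fin k → Bool) → Bool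

def sub {k j : ℕ} (r : R k (j + 1)) (a : Fin k → Bool) : R k j :=
  fun y => r (Fin.snoc (α := fun _ => Fin k → Bool) y a)

theorem avg_sub {k j : ℕ} (a : Fin k → Bool) (φ : R k j → ℝ) :
    (avg fun r : R k (j + 1) => φ (sub r a)) = avg φ := by
  let e1 : R k (j + 1) ≃ ((Fin k → Bool) → R k j) :=
    { toFun := fun r a => sub r a
      invFun := fun s y => s (y (Fin.last j)) (fun i => y i.castSucc)
      left_inv := by
        intro r
        funext y
        simp only [sub]
        congr 1
        exact Fin.snoc_init_self (α := fun _ => Fin k → Bool) y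
      right_inv := by
        intro s
        funext a y
        simp [sub] }
  let e2 := e1.trans (Equiv.funSplitAt a (R k j))
  rw [← avg_fst (κ := {b : Fin k → Bool // b ≠ a} → R k j) φ, ← avg_equiv e2]
  rfl

theorem finish (Mdl : LegitModel n Sunb) (f : BF n) (d : ℕ) {K : ℝ} (hK : 0 < K)
    {φ : (Fin n → Bool) → ℝ} (hc : Cov Mdl (2 * d + 2) K φ) {ι : Type} [Fintype ι] [Nonempty ι]
    (hh : ι → Mdl.M) (hQ : ∀ i, Q Mdl (2 * d + 3) (hh i))
    (hφ : ∀ x, (avg fun i => ind ((hh i).1 x ≠ f x)) ≤ φ x) :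
    ∃ (a b : ℕ) (w : Fin a → ℝ) (δs : Fin a → Set (Fin n → Bool))
      (u : Fin b → ℝ) (hs : Fin b → BF n),
      (∀ i, 0 ≤ w i) ∧ (∑ i, w i) = 1 ∧
      (∀ i, ∃ c : Conn, ∃ hc : c ∈ Sunb, ∃ fs : Fin c.1 → Mdl.M,
        (∀ j, ∃ Cj : Circuit n Sunb, Cj.depth ≤ 2 * d + 2 ∧
          Circuit.approxEval Mdl Cj = fs j) ∧
        δs i = Mdl.errSet c hc fs) ∧
      (∀ i, 0 ≤ u i) ∧ (∑ i, u i) = 1 ∧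
      (∀ i, ∃ D : Circuit n Sunb, D.depth ≤ 2 * d + 3 ∧
        (Circuit.approxEval Mdl D).1 = hs i) ∧
      ∀ x, (∑ i, if hs i x ≠ f x then u i else 0) ≤
        K * (∑ i, if x ∈ δs i then w i else 0) := by
  obtain ⟨W, h0, h1, h2⟩ := hc
  let e := (Fintype.equivFin {δ : Set (Fin n → Bool) // Adm Mdl (2 * d + 2) δ}).symm
  let e' := (Fintype.equivFin ι).symm
  refine ⟨_, _, fun i => K⁻¹ * W (e i), fun i => (e i).1, fun _ => (Fintype.card ι : ℝ)⁻¹,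
    fun i => (hh (e' i)).1, ?_, ?_, ?_, ?_, ?_, ?_, ?_⟩
  · exact fun i => mul_nonneg (inv_nonneg.2 hK.le) (h0 _)
  · rw [← Finset.mul_sum, Equiv.sum_comp e, h1, inv_mul_cancel₀ hK.ne']
  · intro i
    obtain ⟨c, hc, fs, hf, hd⟩ := (e i).2
    exact ⟨c, hc, fs, fun j => (hf j).circuit, hd⟩
  · intro i
    positivity
  · simp
  · intro i
    obtain ⟨C, hC, hC'⟩ := (hQ (e' i)).circuit
    exact ⟨C, hC, by rw [hC']⟩
  · intro x
    refine le_trans (le_of_eq ?_) ((hφ x).trans ((h2 x).trans (le_of_eq ?_)))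
    · rw [Equiv.sum_comp e' (fun i => if (hh i).1 x ≠ f x then (Fintype.card ι : ℝ)⁻¹ else 0)]
      unfold avg ind
      rw [Finset.mul_sum]
      refine Finset.sum_congr rfl fun δ _ => ?_
      split_ifs <;> simp
    · rw [Equiv.sum_comp e (fun δ => if x ∈ δ.1 then K⁻¹ * W δ else 0), Finset.mul_sum]
      refine Finset.sum_congr rfl fun δ _ => ?_
      split_ifs
      · rw [mul_inv_cancel_left₀ hK.ne']
      · simp

theorem not_mem_S : notConn ∈ Sunb := Or.inl rfl
theorem and_mem_S {a : ℕ} (h : 2 ≤ a) : bigAnd a ∈ Sunb := Or.inr ⟨a, h, Or.inl rfl⟩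
theorem or_mem_S {a : ℕ} (h : 2 ≤ a) : bigOr a ∈ Sunb := Or.inr ⟨a, h, Or.inr rfl⟩

section tree

variable (Md : LegitModel n Sunb) (k : ℕ)

def beta (x : Fin n → Bool) (j : ℕ) : Fin k → Bool :=
  fun l => if h : j * k + l.val < n then x ⟨_, h⟩ else false

def bx (x : Fin n → Bool) (j : ℕ) : Fin j → Fin k → Bool := fun i => beta k x i.val

def lit (j : ℕ) (a : Fin k → Bool) (l : Fin k) : Md.M :=
  if h : j * k + l.val < n then
    (if a l then ⟨fun x => x ⟨_, h⟩, Md.var_mem _⟩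
      else Md.approx notConn not_mem_S (fun _ => ⟨fun x => x ⟨_, h⟩, Md.var_mem _⟩))
  else ⟨fun _ => !(a l), Md.const_mem _⟩

theorem lit_val (hneg : Md.NegExact) (j : ℕ) (a : Fin k → Bool) (l : Fin k) (x : Fin n → Bool) :
    (lit Md k j a l).1 x = true ↔ beta k x j l = a l := by
  unfold lit beta
  split_ifs with h h'
  · simp [h']
  · rw [hneg not_mem_S]
    simp [h']
  · change (!(a l)) = true ↔ false = a l
    cases a l <;> simp

theorem lit_Q (j : ℕ) (a : Fin k → Bool) (l : Fin k) : Q Md 1 (lit Md k j a l) := by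
  unfold lit
  split_ifs with h h'
  · exact Q.mono zero_le_one (Q.var _)
  · exact Q.gate (d := 0) _ _ _ (fun _ => Q.var _)
  · exact Q.mono zero_le_one (Q.cst _)

def andIn (j : ℕ) (a : Fin k → Bool) (m : Md.M) : Fin (k + 1) → Md.M :=
  Fin.cons (α := fun _ => Md.M) m (lit Md k j a)

variable (hA : bigAnd (k + 1) ∈ Sunb) (hO : bigOr (2 ^ k) ∈ Sunb)
variable (e : Fin (2 ^ k) ≃ (Fin k → Bool))

def T : (j : ℕ) → R k j → Md.M
  | 0, r => ⟨fun _ => r (fun i => i.elim0), Md.const_mem _⟩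
  | j + 1, r => Md.approx (bigOr (2 ^ k)) hO (fun i =>
      Md.approx (bigAnd (k + 1)) hA (andIn Md k j (e i) (T j (sub r (e i)))))

def orIn (j : ℕ) (r : R k (j + 1)) : Fin (2 ^ k) → Md.M := fun i =>
  Md.approx (bigAnd (k + 1)) hA (andIn Md k j (e i) (T Md k hA hO e j (sub r (e i))))

theorem andIn_Q {D : ℕ} (hD : 1 ≤ D) (j : ℕ) (a : Fin k → Bool) {m : Md.M} (hm : Q Md D m)
    (l : Fin (k + 1)) : Q Md D (andIn Md k j a m l) := by
  unfold andIn
  refine Fin.cases ?_ (fun l => ?_) l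
  · exact hm
  · exact Q.mono hD (lit_Q Md k j a l)

theorem T_Q (j : ℕ) : ∀ r : R k j, Q Md (2 * j + 1) (T Md k hA hO e j r) := by
  induction j with
  | zero => exact fun r => Q.mono (Nat.zero_le _) (Q.cst _)
  | succ j ih =>
    intro r
    exact Q.gate (d := 2 * j + 2) _ hO _ fun i => Q.gate (d := 2 * j + 1) _ hA _ fun l =>
      andIn_Q Md k (by omega) j _ (ih _) l

theorem orIn_Q (j : ℕ) (r : R k (j + 1)) (i) : Q Md (2 * j + 2) (orIn Md k hA hO e j r i) :=
  Q.gate (d := 2 * j + 1) _ hA _ fun l => andIn_Q Md k (by omega) j _ (T_Q _ _ _ _ _ _ _) l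

theorem snoc_bx (x : Fin n → Bool) (j : ℕ) :
    Fin.snoc (α := fun _ => Fin k → Bool) (bx k x j) (beta k x j) = bx k x (j + 1) := by
  funext i
  refine Fin.lastCases ?_ (fun i => ?_) i
  · simp [bx]
  · simp [bx]

theorem andIn_val (hneg : Md.NegExact) (j : ℕ) (a : Fin k → Bool) (m : Md.M) (x : Fin n → Bool) :
    (∀ l, (andIn Md k j a m l).1 x = true) ↔ m.1 x = true ∧ beta k x j = a := by
  rw [Fin.forall_fin_succ]
  simp only [andIn, Fin.cons_zero, Fin.cons_succ, lit_val Md k hneg, funext_iff]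

theorem step (hneg : Md.NegExact) (j : ℕ) (r : R k (j + 1)) (x : Fin n → Bool)
    (h : (T Md k hA hO e (j + 1) r).1 x ≠ r (bx k x (j + 1))) :
    x ∈ Md.errSet _ hO (orIn Md k hA hO e j r) ∨
    (∃ i, x ∈ Md.errSet _ hA (andIn Md k j (e i) (T Md k hA hO e j (sub r (e i))))) ∨
    (T Md k hA hO e j (sub r (beta k x j))).1 x ≠ sub r (beta k x j) (bx k x j) := by
  by_contra hcon
  push Not at hcon
  obtain ⟨h1, h2, h3⟩ := hcon
  apply h
  have h1' : decide (∃ i, (orIn Md k hA hO e j r i).1 x = true) =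
      (T Md k hA hO e (j + 1) r).1 x := not_not.1 h1
  have h2' : ∀ i, decide (∀ l, (andIn Md k j (e i) (T Md k hA hO e j (sub r (e i))) l).1 x = true)
      = (orIn Md k hA hO e j r i).1 x := fun i => not_not.1 (h2 i)
  have h4 : sub r (beta k x j) (bx k x j) = r (bx k x (j + 1)) := by
    unfold sub; rw [snoc_bx]
  rw [← h1', ← h4, ← h3]
  rw [Bool.eq_iff_iff, decide_eq_true_iff]
  simp only [← h2', decide_eq_true_iff, andIn_val Md k hneg]
  constructor
  · rintro ⟨i, hi, hi'⟩
    rw [hi']; exact hi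
  · intro hh
    exact ⟨e.symm (beta k x j), by simpa using hh, by simp⟩

def bad (j : ℕ) (r : R k j) (x : Fin n → Bool) : ℝ :=
  ind ((T Md k hA hO e j r).1 x ≠ r (bx k x j))

theorem step_ind (hneg : Md.NegExact) (j : ℕ) (r : R k (j + 1)) (x : Fin n → Bool) :
    bad Md k hA hO e (j + 1) r x ≤
      (ind (x ∈ Md.errSet _ hO (orIn Md k hA hO e j r)) +
      ∑ i, ind (x ∈ Md.errSet _ hA (andIn Md k j (e i) (T Md k hA hO e j (sub r (e i)))))) +
      bad Md k hA hO e j (sub r (beta k x j)) x := by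
  have n1 := ind_nonneg (x ∈ Md.errSet _ hO (orIn Md k hA hO e j r))
  have n2 : ∀ i ∈ Finset.univ, 0 ≤
      ind (x ∈ Md.errSet _ hA (andIn Md k j (e i) (T Md k hA hO e j (sub r (e i))))) :=
    fun i _ => ind_nonneg _
  have n2' := Finset.sum_nonneg n2
  have n3 : 0 ≤ bad Md k hA hO e j (sub r (beta k x j)) x := ind_nonneg _
  apply ind_le (by positivity)
  intro h
  rcases step Md k hA hO e hneg j r x h with h | ⟨i, h⟩ | h
  · have := ind_of h
    linarith
  · have := ind_of h
    have := Finset.single_le_sum n2 (Finset.mem_univ i)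
    linarith
  · have : bad Md k hA hO e j (sub r (beta k x j)) x = 1 := ind_of h
    linarith

theorem cov_bad (hneg : Md.NegExact) (D j : ℕ) (hj : 2 * j ≤ D) :
    Cov Md D (j * (2 ^ k + 1)) (fun x => avg fun r => bad Md k hA hO e j r x) := by
  induction j with
  | zero =>
    have : Cov Md D 0 (fun _ => 0) := Cov.zero
    refine Cov.mono (by simpa using this) fun x => ?_
    have : ∀ r, bad Md k hA hO e 0 r x = 0 := by
      intro r
      unfold bad ind
      rw [if_neg]
      rw [not_not]
      change r _ = r _
      congr 1
      funext i
      exact i.elim0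
    simp [this, avg]
  | succ j ih =>
    have c1 : ∀ r : R k (j + 1), Cov Md D (1 + (Finset.univ : Finset (Fin (2 ^ k))).card * 1)
        (fun x => ind (x ∈ Md.errSet _ hO (orIn Md k hA hO e j r)) +
      ∑ i, ind (x ∈ Md.errSet _ hA (andIn Md k j (e i) (T Md k hA hO e j (sub r (e i)))))) := by
      intro r
      refine Cov.add (Cov.single ?_) (Cov.sum _ fun i => Cov.single ?_)
      · exact ⟨_, hO, _, fun i => (orIn_Q Md k hA hO e j r i).mono (by omega), rfl⟩
      · exact ⟨_, hA, _, fun i => (andIn_Q Md k (by omega) j _ (T_Q Md k hA hO e j _) i).mono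
          (d := 2 * j + 1) (by omega), rfl⟩
    have c2 := (Cov.avg c1).add (ih (by omega))
    have e1 : ((j + 1 : ℕ) : ℝ) * (2 ^ k + 1) =
        (1 + ((Finset.univ : Finset (Fin (2 ^ k))).card : ℝ) * 1) + j * (2 ^ k + 1) := by
      simp; ring
    rw [e1]
    refine c2.mono fun x => ?_
    rw [← avg_sub (beta k x j) (fun r => bad Md k hA hO e j r x), ← avg_add]
    exact avg_mono fun r => step_ind Md k hA hO e hneg j r x

def sig {j : ℕ} (c g : R k j) : R k j := fun y => xor (g y) (c y)

theorem avg_sig {j : ℕ} (c : R k j) (φ : R k j → ℝ) : (avg fun g => φ (sig k c g)) = avg φ := by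
  have : Function.Involutive (sig k c) := fun g => by
    funext y
    simp [sig]
  exact avg_equiv this.toPerm φ

def pairIn (a b : Md.M) : Fin 2 → Md.M := fun i => if i = 0 then a else b

def and2 (a b : Md.M) : Md.M := Md.approx (bigAnd 2) (and_mem_S le_rfl) (pairIn Md a b)
def or2 (a b : Md.M) : Md.M := Md.approx (bigOr 2) (or_mem_S le_rfl) (pairIn Md a b)
def eAnd (a b : Md.M) := Md.errSet (bigAnd 2) (and_mem_S le_rfl) (pairIn Md a b)
def eOr (a b : Md.M) := Md.errSet (bigOr 2) (or_mem_S le_rfl) (pairIn Md a b)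

theorem pairIn_Q {D : ℕ} {a b : Md.M} (ha : Q Md D a) (hb : Q Md D b) (i) :
    Q Md D (pairIn Md a b i) := by
  unfold pairIn; split_ifs <;> assumption

theorem and2_Q {D : ℕ} {a b : Md.M} (ha : Q Md D a) (hb : Q Md D b) :
    Q Md (D + 1) (and2 Md a b) := Q.gate _ _ _ (pairIn_Q Md ha hb)

theorem or2_Q {D : ℕ} {a b : Md.M} (ha : Q Md D a) (hb : Q Md D b) :
    Q Md (D + 1) (or2 Md a b) := Q.gate _ _ _ (pairIn_Q Md ha hb)

theorem and2_val {a b : Md.M} {x : Fin n → Bool} (h : x ∉ eAnd Md a b) :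
    (and2 Md a b).1 x = (a.1 x && b.1 x) := by
  refine (not_not.1 h).symm.trans ?_
  rw [Bool.eq_iff_iff]
  simp [Fin.forall_fin_two, pairIn]

theorem or2_val {a b : Md.M} {x : Fin n → Bool} (h : x ∉ eOr Md a b) :
    (or2 Md a b).1 x = (a.1 x || b.1 x) := by
  refine (not_not.1 h).symm.trans ?_
  rw [Bool.eq_iff_iff]
  simp [Fin.exists_fin_two, pairIn]

theorem bx_inj (d : ℕ) (hk : 1 ≤ k) (hd : n ≤ d * k) :
    Function.Injective (fun x : Fin n → Bool => bx k x d) := by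
  intro x y hxy
  funext i
  have h1 : i.val / k < d := by
    rw [Nat.div_lt_iff_lt_mul hk]; omega
  have h2 := congrFun (congrFun hxy ⟨i.val / k, h1⟩) ⟨i.val % k, Nat.mod_lt _ hk⟩
  have h3 : i.val / k * k + i.val % k = i.val := by rw [mul_comm]; exact Nat.div_add_mod _ _
  simpa [bx, beta, h3] using h2

theorem core (hA : bigAnd (k + 1) ∈ Sunb) (hO : bigOr (2 ^ k) ∈ Sunb)
    (e : Fin (2 ^ k) ≃ (Fin k → Bool)) (hneg : Md.NegExact) (f : BF n) (d : ℕ) (hk : 1 ≤ k) (hd : n ≤ d * k) :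
    ∃ hh : R k d → Md.M, (∀ g, Q Md (2 * d + 3) (hh g)) ∧
      Cov Md (2 * d + 2) (3 + 4 * (d * (2 ^ k + 1)))
        (fun x => avg fun g => ind ((hh g).1 x ≠ f x)) := by
  obtain ⟨φ, hφ⟩ : ∃ φ : R k d, ∀ x, φ (bx k x d) = f x := by
    refine ⟨fun y => f (Function.invFun (fun x : Fin n → Bool => bx k x d) y), fun x => ?_⟩
    have := Function.leftInverse_invFun (bx_inj k d hk hd) x
    dsimp only at this ⊢
    rw [this]
  let t := T Md k hA hO e d
  let g1 : R k d → R k d := sig k (fun _ => false)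
  let g2 : R k d → R k d := sig k (fun y => !(φ y))
  let g3 : R k d → R k d := sig k (fun _ => true)
  let g4 : R k d → R k d := sig k φ
  have tQ : ∀ g, Q Md (2 * d + 1) (t g) := T_Q Md k hA hO e d
  let B : R k d → (Fin n → Bool) → ℝ := bad Md k hA hO e d
  have cB : Cov Md (2 * d + 2) (d * (2 ^ k + 1)) (fun x => avg fun r => B r x) :=
    cov_bad Md k hA hO e hneg _ d (by omega)
  refine ⟨fun g => or2 Md (and2 Md (t (g1 g)) (t (g2 g))) (and2 Md (t (g3 g)) (t (g4 g))),
    fun g => or2_Q Md (and2_Q Md (tQ _) (tQ _)) (and2_Q Md (tQ _) (tQ _)), ?_⟩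
  have cE : ∀ g, Cov Md (2 * d + 2) (1 + 1 + 1) (fun x =>
      ind (x ∈ eAnd Md (t (g1 g)) (t (g2 g))) + ind (x ∈ eAnd Md (t (g3 g)) (t (g4 g))) +
      ind (x ∈ eOr Md (and2 Md (t (g1 g)) (t (g2 g))) (and2 Md (t (g3 g)) (t (g4 g))))) := by
    intro g
    refine Cov.add (Cov.add (Cov.single ?_) (Cov.single ?_)) (Cov.single ?_)
    · exact ⟨_, _, _, pairIn_Q Md ((tQ _).mono (by omega)) ((tQ _).mono (by omega)), rfl⟩
    · exact ⟨_, _, _, pairIn_Q Md ((tQ _).mono (by omega)) ((tQ _).mono (by omega)), rfl⟩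
    · exact ⟨_, _, _, pairIn_Q Md (and2_Q Md (tQ _) (tQ _)) (and2_Q Md (tQ _) (tQ _)), rfl⟩
  have cc := (Cov.avg cE).add (((cB.add cB).add cB).add cB)
  have e1 : (3 + 4 * (d * (2 ^ k + 1)) : ℝ) = (1 + 1 + 1) + (d * (2 ^ k + 1) + d * (2 ^ k + 1) +
    d * (2 ^ k + 1) + d * (2 ^ k + 1)) := by ring
  rw [e1]
  refine cc.mono fun x => ?_
  have s1 : (avg fun r => B (g1 r) x) = avg fun r => B r x :=
    avg_sig k _ (fun r => B r x)
  have s2 : (avg fun r => B (g2 r) x) = avg fun r => B r x :=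
    avg_sig k _ (fun r => B r x)
  have s3 : (avg fun r => B (g3 r) x) = avg fun r => B r x :=
    avg_sig k _ (fun r => B r x)
  have s4 : (avg fun r => B (g4 r) x) = avg fun r => B r x :=
    avg_sig k _ (fun r => B r x)
  have s : (avg fun r => B r x) + (avg fun r => B r x) + (avg fun r => B r x) +
      (avg fun r => B r x) = avg fun r => B (g1 r) x + B (g2 r) x + B (g3 r) x + B (g4 r) x := by
    rw [avg_add, avg_add, avg_add, s1, s2, s3, s4]
  rw [s, ← avg_add]
  refine avg_mono fun g => ?_
  have n1 := ind_nonneg (x ∈ eAnd Md (t (g1 g)) (t (g2 g)))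
  have n2 := ind_nonneg (x ∈ eAnd Md (t (g3 g)) (t (g4 g)))
  have n3 := ind_nonneg
    (x ∈ eOr Md (and2 Md (t (g1 g)) (t (g2 g))) (and2 Md (t (g3 g)) (t (g4 g))))
  have nB : ∀ g, 0 ≤ B g x := fun g => ind_nonneg _
  have m1 := nB (g1 g)
  have m2 := nB (g2 g)
  have m3 := nB (g3 g)
  have m4 := nB (g4 g)
  have hB : ∀ g, ¬ ((t g).1 x = g (bx k x d)) → B g x = 1 := fun g h => ind_of h
  apply ind_le (by positivity)
  intro hne
  by_cases a1 : x ∈ eAnd Md (t (g1 g)) (t (g2 g))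
  · have := ind_of a1
    linarith
  by_cases a2 : x ∈ eAnd Md (t (g3 g)) (t (g4 g))
  · have := ind_of a2
    linarith
  by_cases a3 : x ∈ eOr Md (and2 Md (t (g1 g)) (t (g2 g))) (and2 Md (t (g3 g)) (t (g4 g)))
  · have := ind_of a3
    linarith
  by_cases b1 : (t (g1 g)).1 x = g1 g (bx k x d)
  swap
  · have := hB _ b1
    linarith
  by_cases b2 : (t (g2 g)).1 x = g2 g (bx k x d)
  swap
  · have := hB _ b2
    linarith
  by_cases b3 : (t (g3 g)).1 x = g3 g (bx k x d)
  swap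
  · have := hB _ b3
    linarith
  by_cases b4 : (t (g4 g)).1 x = g4 g (bx k x d)
  swap
  · have := hB _ b4
    linarith
  exfalso
  apply hne
  rw [or2_val Md a3, and2_val Md a1, and2_val Md a2, b1, b2, b3, b4]
  simp only [g1, g2, g3, g4, sig, hφ]
  cases g (bx k x d) <;> cases f x <;> rfl

end tree

end St10

end
noncomputable section

theorem stmt10 {n : ℕ} (Mdl : LegitModel n Sunb) (hneg : Mdl.NegExact)
    (f : BF n) (d : ℕ) (hd : 1 ≤ d) :
    ∃ (a b : ℕ) (w : Fin a → ℝ) (δs : Fin a → Set (Fin n → Bool))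
      (u : Fin b → ℝ) (hs : Fin b → BF n),
      (∀ i, 0 ≤ w i) ∧ (∑ i, w i) = 1 ∧
      (∀ i, ∃ c : Conn, ∃ hc : c ∈ Sunb, ∃ fs : Fin c.1 → Mdl.M,
        (∀ j, ∃ Cj : Circuit n Sunb, Cj.depth ≤ 2 * d + 2 ∧
          Circuit.approxEval Mdl Cj = fs j) ∧
        δs i = Mdl.errSet c hc fs) ∧
      (∀ i, 0 ≤ u i) ∧ (∑ i, u i) = 1 ∧
      (∀ i, ∃ D : Circuit n Sunb, D.depth ≤ 2 * d + 3 ∧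
        (Circuit.approxEval Mdl D).1 = hs i) ∧
      ∀ x, (∑ i, if hs i x ≠ f x then u i else 0) ≤
        (4 * (d + 1) * (2 ^ natCeilDiv n d + 1) : ℝ) *
          (∑ i, if x ∈ δs i then w i else 0) :=
  by
  have hKpos : (0 : ℝ) < 4 * (d + 1) * (2 ^ natCeilDiv n d + 1) := by positivity
  have adm0 : St10.Adm Mdl (2 * d + 2) (Mdl.errSet (bigAnd 2) (St10.and_mem_S le_rfl)
      (fun _ => ⟨fun _ => false, Mdl.const_mem false⟩)) :=
    ⟨_, _, _, fun _ => St10.Q.mono (Nat.zero_le _) (St10.Q.cst _), rfl⟩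
  have pad : ∀ (K K' : ℝ) (φ : (Fin n → Bool) → ℝ), K ≤ K' → St10.Cov Mdl (2 * d + 2) K φ →
      St10.Cov Mdl (2 * d + 2) K' φ := by
    intro K K' φ hK h
    have h' := h.add ((St10.Cov.single adm0).smul (sub_nonneg.2 hK))
    rw [mul_one, add_sub_cancel] at h'
    refine h'.mono fun x => ?_
    have := mul_nonneg (sub_nonneg.2 hK) (St10.ind_nonneg (x ∈ Mdl.errSet (bigAnd 2)
      (St10.and_mem_S le_rfl) (fun _ => ⟨fun _ => false, Mdl.const_mem false⟩)))
    linarith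
  rcases Nat.eq_zero_or_pos n with hn | hn
  · subst hn
    refine St10.finish Mdl f d hKpos (pad 0 _ _ hKpos.le St10.Cov.zero) (ι := Unit)
      (fun _ => ⟨fun _ => f (fun i => i.elim0), Mdl.const_mem _⟩)
      (fun _ => St10.Q.mono (Nat.zero_le _) (St10.Q.cst _)) ?_
    intro x
    have : x = fun i => i.elim0 := Subsingleton.elim _ _
    simp [this, St10.avg, St10.ind]
  · set k := natCeilDiv n d with hkdef
    have hmul : n ≤ d * k := by
      have h1 := Nat.lt_mul_div_succ (n + d - 1) (show 0 < d from hd)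
      have h2 : (n + d - 1) / d = k := rfl
      rw [h2, mul_add, mul_one] at h1
      omega
    have hk : 1 ≤ k := by
      rcases Nat.eq_zero_or_pos k with h | h
      · rw [h] at hmul; omega
      · exact h
    have h2k : 2 ≤ 2 ^ k := by
      calc 2 = 2 ^ 1 := rfl
        _ ≤ 2 ^ k := Nat.pow_le_pow_right (by norm_num) hk
    have e : Fin (2 ^ k) ≃ (Fin k → Bool) := Fintype.equivOfCardEq (by simp)
    obtain ⟨hh, hQ, hC⟩ := St10.core Mdl k (St10.and_mem_S (by omega)) (St10.or_mem_S h2k) e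
      hneg f d hk hmul
    refine St10.finish Mdl f d hKpos (pad _ _ _ ?_ hC) hh hQ fun x => le_rfl
    have : (0 : ℝ) ≤ 2 ^ k := by positivity
    nlinarith

end
end

section
/- For every n, every f ∈ ℱ_n, and every set F₀ of semi-filters F ⊆ 𝒫(U) with v(F) ∈ V, the fusion distance satisfies ρ_{F₀}(f) ≤ 2 · Size_𝒞(f), where 𝒞 is the class of all Boolean circuits over {¬, ∧₂, ∨₂}. -/
open scoped Classical ENNReal

noncomputable section

/-- The zero set `U = f⁻¹(0)`. -/
def zeros {n : ℕ} (f : BF n) : Set (Fin n → Bool) := {x | f x = false}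

/-- The one set `V = f⁻¹(1)`. -/
def ones {n : ℕ} (f : BF n) : Set (Fin n → Bool) := {x | f x = true}

/-- `F` is a semi-filter on `𝒫(U)`: it contains `U`, does not contain `∅`, and is
monotone (upward closed within subsets of `U`). -/
def IsSemiFilter {α : Type*} (U : Set α) (F : Set (Set α)) : Prop :=
  (∀ A ∈ F, A ⊆ U) ∧ (∅ : Set α) ∉ F ∧ U ∈ F ∧
    ∀ A B : Set α, A ∈ F → A ⊆ B → B ⊆ U → B ∈ F

/-- The pair `P = (A, B)` covers `F` (i.e. `F` does not preserve `(A, B)`). -/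
def CoversPair {α : Type*} (F : Set (Set α)) (P : Set α × Set α) : Prop :=
  P.1 ∈ F ∧ P.2 ∈ F ∧ P.1 ∩ P.2 ∉ F

/-- `[[x_i]]` resp. `[[¬x_i]]` relativized to `W`: the set of `x ∈ W` whose `i`-th bit is `b`. -/
def litSet {n : ℕ} (W : Set (Fin n → Bool)) (i : Fin n) (b : Bool) : Set (Fin n → Bool) :=
  {x | x i = b} ∩ W

/-- `v` is the string `v(F)`: `v(F)_i = F([[x_i]]) ≠ F([[¬x_i]])`. -/
def HasV {n : ℕ} (W : Set (Fin n → Bool)) (F : Set (Set (Fin n → Bool)))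
    (v : Fin n → Bool) : Prop :=
  ∀ i, (v i = true ↔ litSet W i true ∈ F) ∧
    ¬(litSet W i true ∈ F ↔ litSet W i false ∈ F)

/-- The fusion distance `ρ_{F₀}(f)`: the minimal number of pairs of subsets of `W`
covering every semi-filter in `F₀`. -/
def rhoFus {n : ℕ} (W : Set (Fin n → Bool)) (F0 : Set (Set (Set (Fin n → Bool)))) : ℕ∞ :=
  sInf {t : ℕ∞ | ∃ k : ℕ, t = (k : ℕ∞) ∧
    ∃ P : Fin k → Set (Fin n → Bool) × Set (Fin n → Bool),
      (∀ i, (P i).1 ⊆ W ∧ (P i).2 ⊆ W) ∧ ∀ F ∈ F0, ∃ i, CoversPair F (P i)}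

/-- A `d`-semifilter `F = (F⁰, …, F^d)` on `𝒫(U)`. -/
def IsDSemifilter {α : Type*} (U : Set α) (d : ℕ) (F : ℕ → Set (Set α)) : Prop :=
  (∀ k ≤ d, ∀ A ∈ F k, A ⊆ U) ∧
  (∀ k < d, F k ⊆ F (k + 1)) ∧
  (∅ : Set α) ∉ F d ∧ U ∈ F 0 ∧
  ∀ k, 1 ≤ k → k ≤ d → ∀ A B : Set α, B ∈ F (k - 1) → B ⊆ A → A ⊆ U → A ∈ F k

/-- The tuple `A` `k`-covers the `d`-semifilter `F`. -/
def KCovers {α : Type*} {t : ℕ} (F : ℕ → Set (Set α)) (k : ℕ) (A : Fin t → Set α) : Prop :=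
  (∀ i, A i ∈ F (k - 1)) ∧ (⋂ i, A i) ∉ F k

/-- The constant-depth fusion distance `ρ_{F₀,d,t}(f)`: the minimal number of `t`-tuples
of subsets of `W` such that every `(d-1)`-semifilter in `F₀` is `k`-covered by one of the
tuples for some `1 ≤ k < d`. -/
def rhoDFus {n : ℕ} (W : Set (Fin n → Bool)) (d t : ℕ)
    (F0 : Set (ℕ → Set (Set (Fin n → Bool)))) : ℕ∞ :=
  sInf {r : ℕ∞ | ∃ a : ℕ, r = (a : ℕ∞) ∧
    ∃ P : Fin a → (Fin t → Set (Fin n → Bool)),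
      (∀ i j, P i j ⊆ W) ∧ ∀ F ∈ F0, ∃ i, ∃ k, 1 ≤ k ∧ k < d ∧ KCovers F k (P i)}

end

noncomputable section

/-- `[[g]]` for `b = true`, `[[¬g]]` for `b = false`. -/
def brk {n : ℕ} (U : Set (Fin n → Bool)) (g : BF n) (b : Bool) : Set (Fin n → Bool) :=
  {x | g x = b} ∩ U

def GoodAt {n : ℕ} (U : Set (Fin n → Bool)) (F : Set (Set (Fin n → Bool)))
    (v : Fin n → Bool) (g : BF n) : Prop :=
  ∀ b, g v = b ↔ brk U g b ∈ F

lemma brk_sub {n : ℕ} (U : Set (Fin n → Bool)) (g : BF n) (b : Bool) : brk U g b ⊆ U :=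
  fun _ h => h.2

lemma goodAt_of {n : ℕ} {U : Set (Fin n → Bool)} {F : Set (Set (Fin n → Bool))}
    {v : Fin n → Bool} {g : BF n} (hF : IsSemiFilter U F)
    (h : brk U g (g v) ∈ F) (hc : ¬ CoversPair F (brk U g true, brk U g false)) :
    GoodAt U F v g := by
  have hdis : brk U g true ∩ brk U g false = ∅ := by
    ext x
    simp only [brk, Set.mem_inter_iff, Set.mem_ofPred_eq, Set.mem_empty_iff_false, iff_false]
    rintro ⟨⟨h1, _⟩, h2, _⟩
    rw [h1] at h2; cases h2
  have hne : ¬ (brk U g true ∈ F ∧ brk U g false ∈ F) := by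
    rintro ⟨h1, h2⟩
    apply hc
    refine ⟨h1, h2, ?_⟩
    simp only [hdis]
    exact hF.2.1
  intro b
  refine ⟨fun hb => hb ▸ h, fun hb => ?_⟩
  cases b <;> cases hg : g v <;> rw [hg] at h <;> first | rfl | (exfalso; tauto)

lemma goodAt_const {n : ℕ} {U : Set (Fin n → Bool)} {F : Set (Set (Fin n → Bool))}
    {v : Fin n → Bool} (hF : IsSemiFilter U F) (c : Bool) :
    GoodAt U F v (fun _ => c) := by
  intro b
  have h1 : brk U (fun _ => c) b = if c = b then U else ∅ := by
    ext x; by_cases h : c = b <;> simp [brk, h]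
  rw [h1]
  by_cases h : c = b <;> simp [h, hF.2.1, hF.2.2.1]

lemma goodAt_var {n : ℕ} {U : Set (Fin n → Bool)} {F : Set (Set (Fin n → Bool))}
    {v : Fin n → Bool} (hv : HasV U F v) (i : Fin n) :
    GoodAt U F v (fun x => x i) := by
  have h1 : litSet U i = brk U (fun x => x i) := rfl
  obtain ⟨h2, h3⟩ := hv i
  rw [h1] at h2 h3
  intro b
  cases b
  · cases h : v i <;> simp [h] at h2 ⊢ <;> tauto
  · exact h2

lemma gate_pairs {n : ℕ} (U : Set (Fin n → Bool)) (c : Conn) (hc : c ∈ S3)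
    (fs : Fin c.1 → BF n) :
    ∃ P : Fin 2 → Set (Fin n → Bool) × Set (Fin n → Bool),
      (∀ i, (P i).1 ⊆ U ∧ (P i).2 ⊆ U) ∧
      ∀ F v, IsSemiFilter U F → (∀ k, GoodAt U F v (fs k)) → (∀ i, ¬ CoversPair F (P i)) →
        GoodAt U F v (fun x => c.2 (fun k => fs k x)) := by
  rcases hc with rfl | rfl | rfl
  · refine ⟨fun _ => (U, U), fun _ => ⟨subset_rfl, subset_rfl⟩, fun F v hF hg _ b => ?_⟩
    have h := hg 0 (!b)
    have e : brk U (fun x => !(fs 0 x)) b = brk U (fs 0) (!b) := by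
      ext x; simp [brk]
    change (!(fs 0 v)) = b ↔ brk U (fun x => !(fs 0 x)) b ∈ F
    rw [e, ← h]
    cases fs 0 v <;> cases b <;> simp
  · refine ⟨![(brk U (fs 0) true, brk U (fs 1) true),
      (brk U (fun x => fs 0 x && fs 1 x) true, brk U (fun x => fs 0 x && fs 1 x) false)], ?_, ?_⟩
    · intro i; fin_cases i <;> exact ⟨brk_sub _ _ _, brk_sub _ _ _⟩
    · intro F v hF hg hP
      have p0 : ¬ CoversPair F (brk U (fs 0) true, brk U (fs 1) true) := hP 0
      change GoodAt U F v (fun x => fs 0 x && fs 1 x)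
      refine goodAt_of hF ?_ (hP 1)
      have g0 := hg 0
      have g1 := hg 1
      have m := hF.2.2.2
      change brk U _ (fs 0 v && fs 1 v) ∈ F
      cases h0 : fs 0 v
      · refine m _ _ ((g0 false).1 h0) ?_ (brk_sub _ _ _)
        rintro x ⟨hx, hu⟩
        have hx : fs 0 x = false := hx
        exact ⟨by simp [hx], hu⟩
      · cases h1 : fs 1 v
        · refine m _ _ ((g1 false).1 h1) ?_ (brk_sub _ _ _)
          rintro x ⟨hx, hu⟩
          have hx : fs 1 x = false := hx
          exact ⟨by simp [hx], hu⟩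
        · have a0 := (g0 true).1 h0
          have a1 := (g1 true).1 h1
          have : brk U (fs 0) true ∩ brk U (fs 1) true ∈ F := by
            by_contra hh; exact p0 ⟨a0, a1, hh⟩
          refine m _ _ this ?_ (brk_sub _ _ _)
          rintro x ⟨⟨hx, hu⟩, hy, _⟩
          have hx : fs 0 x = true := hx
          have hy : fs 1 x = true := hy
          exact ⟨by simp [hx, hy], hu⟩
  · refine ⟨![(brk U (fs 0) false, brk U (fs 1) false),
      (brk U (fun x => fs 0 x || fs 1 x) true, brk U (fun x => fs 0 x || fs 1 x) false)], ?_, ?_⟩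
    · intro i; fin_cases i <;> exact ⟨brk_sub _ _ _, brk_sub _ _ _⟩
    · intro F v hF hg hP
      have p0 : ¬ CoversPair F (brk U (fs 0) false, brk U (fs 1) false) := hP 0
      change GoodAt U F v (fun x => fs 0 x || fs 1 x)
      refine goodAt_of hF ?_ (hP 1)
      have g0 := hg 0
      have g1 := hg 1
      have m := hF.2.2.2
      change brk U _ (fs 0 v || fs 1 v) ∈ F
      cases h0 : fs 0 v
      · cases h1 : fs 1 v
        · have a0 := (g0 false).1 h0
          have a1 := (g1 false).1 h1
          have : brk U (fs 0) false ∩ brk U (fs 1) false ∈ F := by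
            by_contra hh; exact p0 ⟨a0, a1, hh⟩
          refine m _ _ this ?_ (brk_sub _ _ _)
          rintro x ⟨⟨hx, hu⟩, hy, _⟩
          have hx : fs 0 x = false := hx
          have hy : fs 1 x = false := hy
          exact ⟨by simp [hx, hy], hu⟩
        · refine m _ _ ((g1 true).1 h1) ?_ (brk_sub _ _ _)
          rintro x ⟨hx, hu⟩
          have hx : fs 1 x = true := hx
          exact ⟨by simp [hx], hu⟩
      · refine m _ _ ((g0 true).1 h0) ?_ (brk_sub _ _ _)
        rintro x ⟨hx, hu⟩
        have hx : fs 0 x = true := hx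
        exact ⟨by simp [hx], hu⟩

/-- The function carried by the `k`-th wire of gate `i`. -/
def wireFn {n : ℕ} (C : Circuit n S3) (i : Fin C.size) (k : Fin (C.conn i).1) : BF n :=
  fun x => match C.wires i k with
        | Sum.inl v => x v
        | Sum.inr (Sum.inl b) => b
        | Sum.inr (Sum.inr j) => C.gateVal x j.val

lemma gateVal_eq {n : ℕ} (C : Circuit n S3) (i : Fin C.size) :
    (fun x => C.gateVal x i.val) = fun x => (C.conn i).2 (fun k => wireFn C i k x) := by
  funext x
  obtain ⟨m, h⟩ := i
  rw [Circuit.gateVal, dif_pos h]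
  refine congrArg (C.conn ⟨m, h⟩).2 (funext fun k => ?_)
  unfold wireFn
  rcases C.wires ⟨m, h⟩ k with a | b | j <;> rfl

lemma fus_le_circuit {n : ℕ} (f : BF n) (F0 : Set (Set (Set (Fin n → Bool))))
    (hF0 : ∀ F ∈ F0, IsSemiFilter (zeros f) F ∧ ∃ v, HasV (zeros f) F v ∧ v ∈ ones f)
    (C : Circuit n S3) (hC : C.Computes f) :
    ∃ P : Fin (C.size * 2) → Set (Fin n → Bool) × Set (Fin n → Bool),
      (∀ i, (P i).1 ⊆ zeros f ∧ (P i).2 ⊆ zeros f) ∧ ∀ F ∈ F0, ∃ i, CoversPair F (P i) := by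
  choose P hP1 hP2 using fun i => gate_pairs (zeros f) (C.conn i) (C.conn_mem i) (wireFn C i)
  refine ⟨fun j => P (finProdFinEquiv.symm j).1 (finProdFinEquiv.symm j).2,
    fun j => hP1 _ _, fun F hF => ?_⟩
  by_contra hcon
  push Not at hcon
  have hn : ∀ i j, ¬ CoversPair F (P i j) := fun i j => by
    simpa using hcon (finProdFinEquiv (i, j))
  obtain ⟨hs, v, hv, hv1⟩ := hF0 F hF
  have key : ∀ m (h : m < C.size), GoodAt (zeros f) F v (fun x => C.gateVal x m) := by
    intro m
    induction m using Nat.strong_induction_on with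
    | _ m ih =>
      intro h
      have e := gateVal_eq C ⟨m, h⟩
      change (fun x => C.gateVal x m) = _ at e
      rw [e]
      refine hP2 ⟨m, h⟩ F v hs (fun k => ?_) (hn _)
      unfold wireFn
      rcases C.wires ⟨m, h⟩ k with a | b | j
      · exact goodAt_var hv a
      · exact goodAt_const hs b
      · exact ih j.val j.2 (lt_trans j.2 h)
  have out : GoodAt (zeros f) F v f := by
    have e : f = fun x => C.readPort x C.output := by
      funext x; exact (hC x).symm
    suffices h : GoodAt (zeros f) F v (fun x => C.readPort x C.output) by
      rw [← e] at h; exact h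
    rcases C.output with a | b | j
    · exact goodAt_var hv a
    · exact goodAt_const hs b
    · exact key j.val j.2
  have h1 := (out true).1 hv1
  have h2 : brk (zeros f) f true = ∅ := by
    ext x; simp [brk, zeros]
  rw [h2] at h1
  exact hs.2.1 h1

theorem stmt13 {n : ℕ} (f : BF n) (F0 : Set (Set (Set (Fin n → Bool))))
    (hF0 : ∀ F ∈ F0, IsSemiFilter (zeros f) F ∧ ∃ v, HasV (zeros f) F v ∧ v ∈ ones f) :
    rhoFus (zeros f) F0 ≤ 2 * sizeIn (Set.univ : Set (Circuit n S3)) f := by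
  by_cases hne : {t : ℕ∞ | ∃ C ∈ (Set.univ : Set (Circuit n S3)),
      C.Computes f ∧ t = (C.size : ℕ∞)}.Nonempty
  · obtain ⟨C, _, hC, ht⟩ := csInf_mem hne
    unfold sizeIn
    rw [ht]
    refine sInf_le ⟨C.size * 2, ?_, fus_le_circuit f F0 hF0 C hC⟩
    push_cast
    ring
  · rw [Set.not_nonempty_iff_eq_empty] at hne
    unfold sizeIn
    rw [hne, sInf_empty, ENat.mul_top (by norm_num)]
    exact le_top

end
end

section
/- There is an absolute constant K such that for every n, every f ∈ ℱ_n, and every s ≥ n: if f is not computable by any Boolean circuit over {¬, ∧₂, ∨₂} of size at most K·s³, then ρ_{F_∀}(f) ≥ s, where F_∀ is the set of all semi-filters F ⊆ 𝒫(U) with v(F) ∈ V. -/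
open scoped Classical ENNReal

noncomputable section

section FusionHelpers

/-- Input ports: constants and variables. -/
def hBase (n : ℕ) : Set (BF n) :=
  {g | (∃ b : Bool, g = fun _ => b) ∨ ∃ i : Fin n, g = fun x => x i}

/-- `g` is the result of one gate applied to members of `A`. -/
def hGate {n : ℕ} (A : Set (BF n)) (g : BF n) : Prop :=
  (∃ a ∈ A, g = fun x => !(a x)) ∨ (∃ a ∈ A, ∃ b ∈ A, g = fun x => a x && b x) ∨
    (∃ a ∈ A, ∃ b ∈ A, g = fun x => a x || b x)

inductive hDer {n : ℕ} : ℕ → Set (BF n) → Prop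
  | init : hDer 0 (hBase n)
  | step (N : ℕ) (A : Set (BF n)) (g : BF n) : hDer N A → hGate A g → hDer (N + 1) (insert g A)

lemma hGate_mono {n : ℕ} {A B : Set (BF n)} (h : A ⊆ B) {g : BF n} (hg : hGate A g) :
    hGate B g := by
  rcases hg with ⟨a, ha, e⟩ | ⟨a, ha, b, hb, e⟩ | ⟨a, ha, b, hb, e⟩
  · exact Or.inl ⟨a, h ha, e⟩
  · exact Or.inr (Or.inl ⟨a, h ha, b, h hb, e⟩)
  · exact Or.inr (Or.inr ⟨a, h ha, b, h hb, e⟩)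

lemma hDer_seq {n : ℕ} {N : ℕ} {A : Set (BF n)} (h : hDer N A) :
    ∃ g : ℕ → BF n, A = hBase n ∪ {a | ∃ i < N, a = g i} ∧
      ∀ i < N, hGate (hBase n ∪ {a | ∃ j < i, a = g j}) (g i) := by
  induction h with
  | init => exact ⟨fun _ _ => false, by simp, by simp⟩
  | step N A g0 _ hg ih =>
    obtain ⟨g, hA, hgi⟩ := ih
    have key : ∀ m ≤ N, {a | ∃ j < m, a = Function.update g N g0 j} = {a | ∃ j < m, a = g j} := by
      intro m hm
      ext a
      constructor
      · rintro ⟨j, hj, e⟩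
        refine ⟨j, hj, ?_⟩
        rw [e, Function.update_of_ne (by omega)]
      · rintro ⟨j, hj, e⟩
        refine ⟨j, hj, ?_⟩
        rw [e, Function.update_of_ne (by omega)]
    refine ⟨Function.update g N g0, ?_, ?_⟩
    · have : {a | ∃ i < N + 1, a = Function.update g N g0 i}
          = insert g0 {a | ∃ j < N, a = Function.update g N g0 j} := by
        ext a
        constructor
        · rintro ⟨i, hi, e⟩
          rcases Nat.lt_succ_iff_lt_or_eq.mp hi with h | h
          · exact Or.inr ⟨i, h, e⟩
          · subst h; left; simpa using e
        · rintro (e | ⟨i, hi, e⟩)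
          · exact ⟨N, by omega, by simpa using e⟩
          · exact ⟨i, by omega, e⟩
      rw [this, key N le_rfl, hA, Set.union_insert]
    · intro i hi
      rw [key i (by omega)]
      rcases Nat.lt_succ_iff_lt_or_eq.mp hi with h | h
      · rw [Function.update_of_ne (by omega)]; exact hgi i h
      · subst h; rw [Function.update_self, ← hA]; exact hg

/-- Semantics of a port relative to a sequence of functions. -/
def hPort {n : ℕ} (g : ℕ → BF n) {m : ℕ} (x : Fin n → Bool) :
    (Fin n ⊕ (Bool ⊕ Fin m)) → Bool
  | Sum.inl v => x v
  | Sum.inr (Sum.inl b) => b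
  | Sum.inr (Sum.inr j) => g j.val x

lemma hPort_exists {n : ℕ} (g : ℕ → BF n) (m : ℕ) (a : BF n)
    (ha : a ∈ hBase n ∪ {a | ∃ j < m, a = g j}) :
    ∃ p : Fin n ⊕ (Bool ⊕ Fin m), ∀ x, hPort g x p = a x := by
  rcases ha with (⟨b, rfl⟩ | ⟨i, rfl⟩) | ⟨j, hj, rfl⟩
  · exact ⟨Sum.inr (Sum.inl b), fun _ => rfl⟩
  · exact ⟨Sum.inl i, fun _ => rfl⟩
  · exact ⟨Sum.inr (Sum.inr ⟨j, hj⟩), fun _ => rfl⟩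

lemma hGate_wires {n : ℕ} (g : ℕ → BF n) (m : ℕ) (a : BF n)
    (ha : hGate (hBase n ∪ {a | ∃ j < m, a = g j}) a) :
    ∃ c : Conn, c ∈ S3 ∧ ∃ w : Fin c.1 → (Fin n ⊕ (Bool ⊕ Fin m)),
      ∀ x, c.2 (fun k => hPort g x (w k)) = a x := by
  rcases ha with ⟨a, ha, rfl⟩ | ⟨a, ha, b, hb, rfl⟩ | ⟨a, ha, b, hb, rfl⟩
  · obtain ⟨p, hp⟩ := hPort_exists g m a ha
    exact ⟨notConn, by simp [S3], fun _ => p, fun x => by simp [hp]⟩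
  · obtain ⟨p, hp⟩ := hPort_exists g m a ha
    obtain ⟨q, hq⟩ := hPort_exists g m b hb
    exact ⟨andConn, by simp [S3], ![p, q], fun x => by simp [hp, hq]⟩
  · obtain ⟨p, hp⟩ := hPort_exists g m a ha
    obtain ⟨q, hq⟩ := hPort_exists g m b hb
    exact ⟨orConn, by simp [S3], ![p, q], fun x => by simp [hp, hq]⟩

lemma hDer_circuit {n : ℕ} {N : ℕ} {A : Set (BF n)} (h : hDer N A) {f : BF n} (hf : f ∈ A) :
    ∃ C : Circuit n S3, C.size = N ∧ C.Computes f := by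
  obtain ⟨g, rfl, hg⟩ := hDer_seq h
  obtain ⟨p, hp⟩ := hPort_exists g N f hf
  choose c hc w hw using fun i : Fin N => hGate_wires g i.val (g i.val) (hg i.val i.isLt)
  let C : Circuit n S3 := ⟨N, c, hc, w, p⟩
  have hv : ∀ (x : Fin n → Bool) (i : ℕ), i < N → C.gateVal x i = g i x := by
    intro x i
    induction i using Nat.strong_induction_on with
    | _ i ih =>
      intro hi
      rw [Circuit.gateVal, dif_pos (show i < C.size from hi), ← hw ⟨i, hi⟩ x]
      change (c ⟨i, hi⟩).2 _ = _
      refine congrArg (c ⟨i, hi⟩).2 (funext fun k => ?_)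
      change _ = hPort g x (C.wires ⟨i, hi⟩ k)
      generalize C.wires ⟨i, hi⟩ k = q
      rcases q with v | b | j
      · rfl
      · rfl
      · exact ih j.val j.isLt (lt_trans j.isLt hi)
  refine ⟨C, rfl, fun x => ?_⟩
  rw [← hp x]
  change C.readPort x p = _
  rcases p with v | b | j
  · rfl
  · rfl
  · exact hv x j.val j.isLt

/-- From the functions in `A0` one obtains those in `G` with at most `m` further gates. -/
def hCost {n : ℕ} (A0 : Set (BF n)) (m : ℕ) (G : Set (BF n)) : Prop :=
  ∀ N A, A0 ⊆ A → hDer N A → ∃ N' A', A ⊆ A' ∧ hDer N' A' ∧ N' ≤ N + m ∧ G ⊆ A'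

lemma hDer_base {n N : ℕ} {A : Set (BF n)} (h : hDer N A) : hBase n ⊆ A := by
  induction h with
  | init => exact subset_rfl
  | step N A g _ _ ih => exact ih.trans (Set.subset_insert _ _)

lemma hCost.trans {n : ℕ} {A0 G1 G2 : Set (BF n)} {m1 m2 : ℕ} (h1 : hCost A0 m1 G1)
    (h2 : hCost (A0 ∪ G1) m2 G2) : hCost A0 (m1 + m2) (G1 ∪ G2) := by
  intro N A hA hN
  obtain ⟨N1, A1, a1, d1, l1, g1⟩ := h1 N A hA hN
  obtain ⟨N2, A2, a2, d2, l2, g2⟩ := h2 N1 A1 (Set.union_subset (hA.trans a1) g1) d1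
  exact ⟨N2, A2, a1.trans a2, d2, by omega, Set.union_subset (g1.trans a2) g2⟩

lemma hCost.mono {n : ℕ} {A0 A1 G1 G2 : Set (BF n)} {m1 m2 : ℕ} (h1 : hCost A0 m1 G1)
    (hA : A0 ⊆ A1) (hm : m1 ≤ m2) (hG : G2 ⊆ G1) : hCost A1 m2 G2 := by
  intro N A hA' hN
  obtain ⟨N1, A1, a1, d1, l1, g1⟩ := h1 N A (hA.trans hA') hN
  exact ⟨N1, A1, a1, d1, by omega, hG.trans g1⟩

lemma hCost.seq {n : ℕ} {A0 G1 G2 : Set (BF n)} {m1 m2 : ℕ} (h1 : hCost A0 m1 G1)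
    (h2 : hCost (A0 ∪ G1) m2 G2) : hCost A0 (m1 + m2) G2 :=
  (h1.trans h2).mono subset_rfl le_rfl Set.subset_union_right

lemma hCost_mem {n : ℕ} {A0 G : Set (BF n)} (h : G ⊆ A0 ∪ hBase n) : hCost A0 0 G := by
  intro N A hA hN
  exact ⟨N, A, subset_rfl, hN, le_rfl, h.trans (Set.union_subset hA (hDer_base hN))⟩

lemma hCost_gate {n : ℕ} {A0 : Set (BF n)} {g : BF n} (h : hGate A0 g) : hCost A0 1 {g} := by
  intro N A hA hN
  exact ⟨N + 1, insert g A, Set.subset_insert _ _, hDer.step N A g hN (hGate_mono hA h), le_rfl,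
    by simp⟩

lemma hCost_list {n : ℕ} {ι : Type} {A0 : Set (BF n)} {m : ℕ} (h : ι → BF n) (L : List ι)
    (hh : ∀ i ∈ L, hCost A0 m {h i}) : hCost A0 (L.length * m) {g | ∃ i ∈ L, g = h i} := by
  induction L with
  | nil => exact (hCost_mem (G := ∅) (by simp)).mono subset_rfl (by simp) (by simp)
  | cons i L ih =>
    have h1 := ih (fun j hj => hh j (by simp [hj]))
    have h2 := (hh i (by simp)).mono (Set.subset_union_left (t := {g | ∃ i ∈ L, g = h i}))
      le_rfl subset_rfl
    refine (h1.trans h2).mono subset_rfl (by simp [Nat.succ_mul]) ?_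
    rintro g ⟨j, hj, rfl⟩
    rcases List.mem_cons.mp hj with rfl | hj
    · right; rfl
    · left; exact ⟨j, hj, rfl⟩

lemma hCost_fintype {n : ℕ} {ι : Type} [Fintype ι] {A0 : Set (BF n)} {m : ℕ} (h : ι → BF n)
    (hh : ∀ i, hCost A0 m {h i}) : hCost A0 (Fintype.card ι * m) (Set.range h) := by
  have := hCost_list h (Finset.univ : Finset ι).toList (fun i _ => hh i)
  refine this.mono subset_rfl (by simp) ?_
  rintro g ⟨i, rfl⟩
  exact ⟨i, by simp, rfl⟩

lemma hCost_orList {n : ℕ} {ι : Type} {A0 : Set (BF n)} (h : ι → BF n) (L : List ι)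
    (hh : ∀ i ∈ L, h i ∈ A0 ∪ hBase n) :
    hCost A0 L.length {fun x => decide (∃ i ∈ L, h i x = true)} := by
  induction L with
  | nil =>
    refine hCost_mem ?_
    rintro g rfl
    right; left; exact ⟨false, by simp⟩
  | cons i L ih =>
    have h1 := ih (fun j hj => hh j (by simp [hj]))
    have h0 : hCost A0 0 {h i} := hCost_mem (by simpa using hh i (by simp))
    have h3 := h0.trans (h1.mono Set.subset_union_left le_rfl subset_rfl)
    refine (h3.seq (m2 := 1) (hCost_gate ?_)).mono subset_rfl (by simp) subset_rfl
    refine Or.inr (Or.inr ⟨h i, by simp, _, Or.inr (Or.inr rfl), ?_⟩)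
    funext x
    rw [Bool.eq_iff_iff]
    simp

lemma hCost_or {n : ℕ} {ι : Type} [Fintype ι] {A0 : Set (BF n)} (h : ι → BF n)
    (hh : ∀ i, h i ∈ A0 ∪ hBase n) :
    hCost A0 (Fintype.card ι) {fun x => decide (∃ i, h i x = true)} := by
  have := hCost_orList h (Finset.univ : Finset ι).toList (fun i _ => hh i)
  refine this.mono subset_rfl (by simp) ?_
  rintro g rfl
  simp

/-- One-step derivability of the set `S`. -/
def hD {n k : ℕ} (U : Set (Fin n → Bool)) (P : Fin k → Set (Fin n → Bool) × Set (Fin n → Bool))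
    (v : Fin n → Bool) (y : Finset (Fin k)) (S : Set (Fin n → Bool)) : Prop :=
  U ⊆ S ∨ (∃ i, litSet U i (v i) ⊆ S) ∨ ∃ l ∈ y, (P l).1 ∩ (P l).2 ⊆ S

def hPhi {n k : ℕ} (U : Set (Fin n → Bool)) (P : Fin k → Set (Fin n → Bool) × Set (Fin n → Bool))
    (v : Fin n → Bool) (y : Finset (Fin k)) : Finset (Fin k) :=
  Finset.univ.filter (fun j => hD U P v y (P j).1 ∧ hD U P v y (P j).2)

def hY {n k : ℕ} (U : Set (Fin n → Bool)) (P : Fin k → Set (Fin n → Bool) × Set (Fin n → Bool))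
    (v : Fin n → Bool) (t : ℕ) : Finset (Fin k) := (hPhi U P v)^[t] ∅

lemma hPhi_mono {n k : ℕ} (U : Set (Fin n → Bool))
    (P : Fin k → Set (Fin n → Bool) × Set (Fin n → Bool)) (v : Fin n → Bool) :
    Monotone (hPhi U P v) := by
  have key : ∀ y z : Finset (Fin k), y ⊆ z → ∀ S, hD U P v y S → hD U P v z S := by
    rintro y z hyz S (h | h | ⟨l, hl, h⟩)
    · exact Or.inl h
    · exact Or.inr (Or.inl h)
    · exact Or.inr (Or.inr ⟨l, hyz hl, h⟩)
  intro y z hyz j hj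
  simp only [hPhi, Finset.mem_filter, Finset.mem_univ, true_and] at hj ⊢
  exact ⟨key y z hyz _ hj.1, key y z hyz _ hj.2⟩

lemma hY_succ {n k : ℕ} (U : Set (Fin n → Bool))
    (P : Fin k → Set (Fin n → Bool) × Set (Fin n → Bool)) (v : Fin n → Bool) (t : ℕ) :
    hY U P v (t + 1) = hPhi U P v (hY U P v t) := Function.iterate_succ_apply' _ _ _

lemma hY_le {n k : ℕ} (U : Set (Fin n → Bool))
    (P : Fin k → Set (Fin n → Bool) × Set (Fin n → Bool)) (v : Fin n → Bool) (t : ℕ) :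
    hY U P v t ⊆ hY U P v (t + 1) := by
  induction t with
  | zero => simp [hY]
  | succ t ih => rw [hY_succ, hY_succ _ _ _ (t + 1)]; exact hPhi_mono U P v ih

lemma hY_fix {n k : ℕ} (U : Set (Fin n → Bool))
    (P : Fin k → Set (Fin n → Bool) × Set (Fin n → Bool)) (v : Fin n → Bool) :
    hPhi U P v (hY U P v k) = hY U P v k := by
  have key : ∀ t, hY U P v (t + 1) = hY U P v t ∨ t + 1 ≤ (hY U P v (t + 1)).card := by
    intro t
    induction t with
    | zero =>
      by_cases h : hY U P v 1 = hY U P v 0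
      · exact Or.inl h
      · right
        have := Finset.card_lt_card (lt_of_le_of_ne (hY_le U P v 0) (Ne.symm h))
        simp only [zero_add] at this ⊢
        omega
    | succ t ih =>
      by_cases h : hY U P v (t + 1 + 1) = hY U P v (t + 1)
      · exact Or.inl h
      · right
        have h2 := Finset.card_lt_card (lt_of_le_of_ne (hY_le U P v (t + 1)) (Ne.symm h))
        rcases ih with ih | ih
        · exact absurd (by rw [hY_succ _ _ _ (t + 1), ih, ← hY_succ, ih]) h
        · omega
  rw [← hY_succ]
  rcases key k with h | h
  · exact h
  · have := Finset.card_le_univ (hY U P v (k + 1))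
    rw [Fintype.card_fin] at this
    omega

/-- The accepting condition of the final circuit. -/
def hAcc {n k : ℕ} (U : Set (Fin n → Bool)) (P : Fin k → Set (Fin n → Bool) × Set (Fin n → Bool))
    (v : Fin n → Bool) : Prop :=
  hD U P v (hY U P v k) ∅ ∨ ∃ i, hD U P v (hY U P v k) (litSet U i (!(v i)))

lemma hAcc_iff {n k : ℕ} (f : BF n) (P : Fin k → Set (Fin n → Bool) × Set (Fin n → Bool))
    (hP : ∀ i, (P i).1 ⊆ zeros f ∧ (P i).2 ⊆ zeros f)
    (hc : ∀ F ∈ {F | IsSemiFilter (zeros f) F ∧ ∃ v, HasV (zeros f) F v ∧ v ∈ ones f},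
      ∃ i, CoversPair F (P i)) (v : Fin n → Bool) :
    hAcc (zeros f) P v ↔ f v = true := by
  set U := zeros f with hU
  constructor
  · intro h
    by_contra hf
    have hvU : v ∈ U := by simpa [hU, zeros] using hf
    have hl : ∀ i, v ∈ litSet U i (v i) := fun i => ⟨rfl, hvU⟩
    have s1 : ∀ y : Finset (Fin k), (∀ j ∈ y, v ∈ (P j).1 ∩ (P j).2) →
        ∀ S, hD U P v y S → v ∈ S := by
      rintro y hy S (h | ⟨i, h⟩ | ⟨l, hl, h⟩)
      · exact h hvU
      · exact h (hl i)
      · exact h (hy l hl)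
    have s2 : ∀ t, ∀ j ∈ hY U P v t, v ∈ (P j).1 ∩ (P j).2 := by
      intro t
      induction t with
      | zero => simp [hY]
      | succ t ih =>
        intro j hj
        rw [hY_succ] at hj
        simp only [hPhi, Finset.mem_filter, Finset.mem_univ, true_and] at hj
        exact ⟨s1 _ ih _ hj.1, s1 _ ih _ hj.2⟩
    rcases h with h | ⟨i, h⟩
    · exact s1 _ (s2 k) _ h
    · have := (s1 _ (s2 k) _ h).1
      simp at this
  · intro hf
    by_contra h
    simp only [hAcc, not_or, not_exists] at h
    obtain ⟨h0, h1⟩ := h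
    set y := hY U P v k with hy
    have lin : ∀ i, hD U P v y (litSet U i (v i)) := fun i => Or.inr (Or.inl ⟨i, subset_rfl⟩)
    have lsub : ∀ i b, litSet U i b ⊆ U := fun i b => Set.inter_subset_right
    obtain ⟨j, hj1, hj2, hj3⟩ := hc {S | S ⊆ U ∧ hD U P v y S} (by
      refine ⟨⟨fun A hA => hA.1, fun hA => h0 hA.2, ⟨subset_rfl, Or.inl subset_rfl⟩, ?_⟩, v, ?_, hf⟩
      · rintro A B ⟨hA, hD'⟩ hAB hB
        refine ⟨hB, ?_⟩
        rcases hD' with h | ⟨i, h⟩ | ⟨l, hl, h⟩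
        · exact Or.inl (h.trans hAB)
        · exact Or.inr (Or.inl ⟨i, h.trans hAB⟩)
        · exact Or.inr (Or.inr ⟨l, hl, h.trans hAB⟩)
      · intro i
        have a := lin i
        have b := h1 i
        simp only [Set.mem_ofPred_eq, lsub, true_and]
        cases hv : v i <;> simp [hv] at a b <;> simp [a, b])
    refine hj3 ⟨Set.inter_subset_left.trans (hP j).1, Or.inr (Or.inr ⟨j, ?_, subset_rfl⟩)⟩
    rw [hy, ← hY_fix]
    simp only [hPhi, Finset.mem_filter, Finset.mem_univ, true_and]
    exact ⟨hj1.2, hj2.2⟩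

/-- The literals. -/
def hLit {n : ℕ} (p : Fin n × Bool) : BF n := fun x => if p.2 then x p.1 else !(x p.1)

lemma hLit_iff {n : ℕ} (p : Fin n × Bool) (x : Fin n → Bool) :
    hLit p x = true ↔ x p.1 = p.2 := by
  obtain ⟨i, b⟩ := p
  cases b <;> simp [hLit]

lemma hCost_lit {n : ℕ} : hCost (∅ : Set (BF n)) (n * 2) (Set.range hLit) := by
  have := hCost_fintype (A0 := (∅ : Set (BF n))) (m := 1) hLit (by
    rintro ⟨i, b⟩
    have h0 : hCost (∅ : Set (BF n)) 0 {fun x => x i} :=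
      hCost_mem (by rintro g rfl; right; right; exact ⟨i, rfl⟩)
    cases b
    · refine (h0.seq (hCost_gate (g := hLit (i, false)) (Or.inl ⟨_, Or.inr rfl, ?_⟩)))
      funext x
      simp [hLit]
    · refine h0.mono subset_rfl (by simp) ?_
      rintro g rfl
      rw [Set.mem_singleton_iff]
      funext x
      simp [hLit])
  exact this.mono subset_rfl (by simp) subset_rfl

/-- Available at round `t`. -/
def hSt {n k : ℕ} (U : Set (Fin n → Bool)) (P : Fin k → Set (Fin n → Bool) × Set (Fin n → Bool))
    (t : ℕ) : Set (BF n) :=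
  Set.range hLit ∪ Set.range (fun j : Fin k => fun x => decide (j ∈ hY U P x t))

lemma hCost_D {n k : ℕ} (U : Set (Fin n → Bool))
    (P : Fin k → Set (Fin n → Bool) × Set (Fin n → Bool)) (t : ℕ) (S : Set (Fin n → Bool)) :
    hCost (hSt U P t) (1 + n * 2 + k) {fun x => decide (hD U P x (hY U P x t) S)} := by
  have hb : ∀ b : Bool, (fun _ => b) ∈ hSt U P t ∪ hBase n := fun b => Or.inr (Or.inl ⟨b, rfl⟩)
  have := hCost_or (A0 := hSt U P t) (ι := Unit ⊕ (Fin n × Bool) ⊕ Fin k)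
    (Sum.elim (fun _ => fun _ => decide (U ⊆ S))
      (Sum.elim (fun p => if litSet U p.1 p.2 ⊆ S then hLit p else fun _ => false)
        (fun l => if (P l).1 ∩ (P l).2 ⊆ S then (fun x => decide (l ∈ hY U P x t))
          else fun _ => false)))
    (by
      rintro (u | p | l)
      · exact hb _
      · simp only [Sum.elim_inr, Sum.elim_inl]
        split_ifs
        · left; left; exact ⟨p, rfl⟩
        · exact hb _
      · simp only [Sum.elim_inr]
        split_ifs
        · left; right; exact ⟨l, rfl⟩
        · exact hb _)
  refine this.mono subset_rfl (by simp; omega) ?_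
  rintro g rfl
  rw [Set.mem_singleton_iff]
  funext x
  rw [decide_eq_decide]
  simp only [Sum.exists, Sum.elim_inl, Sum.elim_inr, hD]
  refine or_congr (by simp) (or_congr ?_ ?_)
  · constructor
    · rintro ⟨i, hi⟩
      refine ⟨(i, x i), ?_⟩
      rw [if_pos hi, hLit_iff]
    · rintro ⟨p, hp⟩
      split_ifs at hp with h
      · rw [hLit_iff] at hp
        exact ⟨p.1, by rw [hp]; exact h⟩
  · refine exists_congr fun l => ?_
    split_ifs with h <;> simp [h]

lemma hCost_round {n k : ℕ} (U : Set (Fin n → Bool))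
    (P : Fin k → Set (Fin n → Bool) × Set (Fin n → Bool)) (t : ℕ) :
    hCost (hSt U P t) (k * (2 * (1 + n * 2 + k) + 1)) (hSt U P (t + 1)) := by
  have h1 := hCost_fintype (A0 := hSt U P t) (m := 2 * (1 + n * 2 + k) + 1)
    (fun j : Fin k => fun x => decide (j ∈ hY U P x (t + 1))) (by
      intro j
      have a := hCost_D U P t (P j).1
      have b := hCost_D U P t (P j).2
      have c := a.trans (b.mono Set.subset_union_left le_rfl subset_rfl)
      refine (c.seq (m2 := 1) (hCost_gate ?_)).mono subset_rfl (by omega) subset_rfl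
      refine Or.inr (Or.inl ⟨_, Or.inr (Or.inl rfl), _, Or.inr (Or.inr rfl), ?_⟩)
      funext x
      rw [hY_succ, Bool.eq_iff_iff]
      simp [hPhi])
  have h0 : hCost (hSt U P t) 0 (Set.range hLit) := hCost_mem (fun g hg => Or.inl (Or.inl hg))
  refine (h0.trans (h1.mono Set.subset_union_left le_rfl subset_rfl)).mono subset_rfl
    (by simp) subset_rfl

lemma hCost_rounds {n k : ℕ} (U : Set (Fin n → Bool))
    (P : Fin k → Set (Fin n → Bool) × Set (Fin n → Bool)) (t : ℕ) :
    hCost (Set.range hLit) (t * (k * (2 * (1 + n * 2 + k) + 1))) (hSt U P t) := by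
  induction t with
  | zero =>
    refine (hCost_mem ?_).mono subset_rfl (Nat.zero_le _) subset_rfl
    rintro g (hg | ⟨j, rfl⟩)
    · exact Or.inl hg
    · right; left; exact ⟨false, by simp [hY]⟩
  | succ t ih =>
    exact (ih.seq ((hCost_round U P t).mono Set.subset_union_right le_rfl subset_rfl)).mono
      subset_rfl (le_of_eq (Nat.succ_mul _ _).symm) subset_rfl

lemma hCost_acc {n k : ℕ} (U : Set (Fin n → Bool))
    (P : Fin k → Set (Fin n → Bool) × Set (Fin n → Bool)) :
    hCost (hSt U P k) ((1 + n * 2 + k) + n * 2 * (1 + n * 2 + k + 1) + (1 + n * 2))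
      {fun x => decide (hAcc U P x)} := by
  have h1 := hCost_fintype (A0 := hSt U P k) (m := 1 + n * 2 + k + 1)
    (fun p : Fin n × Bool => fun x =>
      hLit p x && decide (hD U P x (hY U P x k) (litSet U p.1 (!p.2)))) (by
      intro p
      refine (hCost_D U P k (litSet U p.1 (!p.2))).seq (hCost_gate ?_)
      exact Or.inr (Or.inl ⟨hLit p, Or.inl (Or.inl ⟨p, rfl⟩), _, Or.inr rfl, rfl⟩))
  have h2 := (hCost_D U P k ∅).trans (h1.mono Set.subset_union_left le_rfl subset_rfl)
  refine (h2.seq (hCost_or (ι := Unit ⊕ (Fin n × Bool))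
    (Sum.elim (fun _ => fun x => decide (hD U P x (hY U P x k) ∅)) (fun p => fun x =>
      hLit p x && decide (hD U P x (hY U P x k) (litSet U p.1 (!p.2))))) ?_)).mono
      subset_rfl (by simp) ?_
  · rintro (u | p)
    · exact Or.inl (Or.inr (Or.inl rfl))
    · exact Or.inl (Or.inr (Or.inr ⟨p, rfl⟩))
  · rintro g rfl
    rw [Set.mem_singleton_iff]
    funext x
    rw [decide_eq_decide]
    simp only [Sum.exists, Sum.elim_inl, Sum.elim_inr, hAcc, Bool.and_eq_true, hLit_iff]
    refine or_congr (by simp) ?_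
    constructor
    · rintro ⟨i, hi⟩
      exact ⟨(i, x i), rfl, by simpa using hi⟩
    · rintro ⟨p, hp, h⟩
      exact ⟨p.1, by rw [hp]; simpa using h⟩

end FusionHelpers

theorem stmt14 :
    ∃ K : ℕ, ∀ (n : ℕ) (f : BF n) (s : ℕ), n ≤ s →
      (∀ C : Circuit n S3, C.size ≤ K * s ^ 3 → ¬ C.Computes f) →
      (s : ℕ∞) ≤ rhoFus (zeros f)
        {F | IsSemiFilter (zeros f) F ∧ ∃ v, HasV (zeros f) F v ∧ v ∈ ones f} := by
  refine ⟨100, fun n f s hn hC => ?_⟩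
  refine le_sInf ?_
  rintro _ ⟨k, rfl, P, hP, hc⟩
  by_contra hlt
  have hk : k < s := by
    rw [not_le] at hlt
    exact_mod_cast hlt
  have hcost := (hCost_lit (n := n)).seq (((hCost_rounds (zeros f) P k).seq
    ((hCost_acc (zeros f) P).mono Set.subset_union_right le_rfl subset_rfl)).mono
      Set.subset_union_right le_rfl subset_rfl)
  obtain ⟨N, A, -, hder, hN, hG⟩ := hcost 0 _ (Set.empty_subset _) hDer.init
  obtain ⟨C, hs, hcomp⟩ := hDer_circuit hder (hG rfl)
  refine hC C ?_ (fun x => ?_)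
  · rw [hs]
    refine hN.trans ?_
    have hD3 : 1 + n * 2 + k ≤ 3 * s := by omega
    have hs1 : 1 ≤ s := by omega
    have e1 : k * (k * (2 * (1 + n * 2 + k) + 1)) ≤ s * (s * (7 * s)) :=
      Nat.mul_le_mul hk.le (Nat.mul_le_mul hk.le (by omega))
    have e2 : n * 2 * (1 + n * 2 + k + 1) ≤ (s * 2) * (4 * s) :=
      Nat.mul_le_mul (by omega) (by omega)
    have e3 : s * s ≤ s ^ 3 := by nlinarith [Nat.mul_le_mul hs1 (le_refl (s * s))]
    have e4 : s ≤ s ^ 3 := by nlinarith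
    have e5 : s * (s * (7 * s)) = 7 * s ^ 3 := by ring
    have e6 : (s * 2) * (4 * s) = 8 * (s * s) := by ring
    omega
  · rw [hcomp x, Bool.eq_iff_iff, decide_eq_true_iff]
    exact hAcc_iff f P hP hc x

end
end
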